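/- arXiv:1507.00198 — 9 statements merged into one kernel-verified Lean document; each statement's English description precedes it below -/
import Mathlib

section
/- Suppose s(n) is a real polynomial with positive degree d and positive leading coefficient, and C : ℕ → ℂ is a periodic function with period k and mean zero. Then lim_{q→1⁻} Σ_{n≥0} C(n) q^{s(n)} = (−C(1) − 2C(2) − ⋯ − (k−1)C(k−1))/k, i.e. the limit equals −(1/k)·Σ_{j=1}^{k−1} j·C(j), where the limit is taken over q ∈ (0,1). -/
open Filter Topology

lemma aux_per (f : ℕ → ℂ) (k : ℕ) (hper : ∀ n, f (n + k) = f n)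
    (h0 : ∑ j ∈ Finset.range k, f j = 0) (n : ℕ) :
    ∑ j ∈ Finset.range (n + k), f j = ∑ j ∈ Finset.range n, f j := by
  induction n with
  | zero => simpa using h0
  | succ n ih =>
    rw [Nat.add_right_comm, Finset.sum_range_succ, ih, Finset.sum_range_succ, hper]

lemma aux_bdd (g : ℕ → ℂ) (k : ℕ) (hk : 0 < k) (hper : ∀ n, g (n + k) = g n) :
    ∃ B : ℝ, 0 ≤ B ∧ ∀ n, ‖g n‖ ≤ B := by
  refine ⟨∑ i ∈ Finset.range k, ‖g i‖, Finset.sum_nonneg (fun _ _ => norm_nonneg _), fun n => ?_⟩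
  have hp : Function.Periodic g k := hper
  rw [← hp.map_mod_nat n]
  exact Finset.single_le_sum (f := fun i => ‖g i‖) (fun _ _ => norm_nonneg _)
    (Finset.mem_range.2 (Nat.mod_lt n hk))

lemma aux_mean (C : ℕ → ℂ) (K : ℕ) :
    ∑ n ∈ Finset.range K, ∑ i ∈ Finset.range (n + 1), C i =
      K * ∑ i ∈ Finset.range K, C i - ∑ i ∈ Finset.range K, (i : ℂ) * C i := by
  induction K with
  | zero => simp
  | succ K ih =>
    rw [Finset.sum_range_succ, ih, Finset.sum_range_succ _ K, Finset.sum_range_succ _ K]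
    push_cast; ring

lemma aux_abel (C a : ℕ → ℂ) (M : ℂ) (S V : ℕ → ℂ) (hS0 : S 0 = 0) (hV0 : V 0 = 0)
    (hS : ∀ n, S (n + 1) = S n + C n) (hV : ∀ n, V (n + 1) = V n + (S (n + 1) - M)) (K : ℕ) :
    ∑ n ∈ Finset.range K, C n * a n =
      M * a 0 + ((S K - M) * a K + V K * (a K - a (K + 1))) +
      ∑ n ∈ Finset.range K, V (n + 1) * (a n - 2 * a (n + 1) + a (n + 2)) := by
  induction K with
  | zero => simp [hS0, hV0]
  | succ K ih =>
    rw [Finset.sum_range_succ, ih, Finset.sum_range_succ, hV K, hS K]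
    ring

set_option maxHeartbeats 2000000 in
/-- second difference estimate -/
lemma aux_diff (t ε s δ δ' : ℝ) (ht : 0 < t) (hε : 0 ≤ ε) (hδ : 0 < δ) (hδ' : 0 < δ')
    (h1 : |δ' - δ| ≤ ε * δ) (h2 : δ ≤ ε * s) :
    |Real.exp (-t * s) - 2 * Real.exp (-t * (s + δ)) + Real.exp (-t * (s + δ + δ'))| ≤
      6 * ε * (Real.exp (-t * s / 2) - Real.exp (-t * (s + δ) / 2)) := by
  set x := Real.exp (-t * s / 2) with hx
  set y := Real.exp (-t * δ / 2) with hy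
  have e1 : Real.exp (-t * s) = x ^ 2 := by rw [hx, ← Real.exp_nat_mul]; congr 1; push_cast; ring
  have e2 : Real.exp (-t * (s + δ)) = x ^ 2 * y ^ 2 := by
    rw [hx, hy, ← Real.exp_nat_mul, ← Real.exp_nat_mul, ← Real.exp_add]; congr 1; push_cast; ring
  have e3 : Real.exp (-t * (s + δ + δ')) = x ^ 2 * y ^ 2 * Real.exp (-t * δ') := by
    rw [← e2, ← Real.exp_add]; congr 1; ring
  have e4 : Real.exp (-t * (s + δ) / 2) = x * y := by
    rw [hx, hy, ← Real.exp_add]; congr 1; ring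
  have e5 : Real.exp (-t * δ) = y ^ 2 := by rw [hy, ← Real.exp_nat_mul]; congr 1; push_cast; ring
  have hxp : 0 < x := Real.exp_pos _
  have hyp : 0 < y := Real.exp_pos _
  have hy1 : y ≤ 1 := Real.exp_le_one_iff.2 (by nlinarith)
  have hs : 0 ≤ ε * s := hδ.le.trans h2
  -- x * (t*s) ≤ 2 scaled by ε
  have f1 : x * (1 - y ^ 2) ≤ 2 * ε := by
    have g1 : 1 - y ^ 2 ≤ t * δ := by
      rw [← e5]; linarith [Real.add_one_le_exp (-t * δ)]
    have g2 : t * s / 2 * x ≤ 1 := by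
      have : t * s / 2 ≤ Real.exp (t * s / 2) := by linarith [Real.add_one_le_exp (t * s / 2)]
      calc t * s / 2 * x ≤ Real.exp (t * s / 2) * x := by gcongr
        _ = 1 := by rw [hx, ← Real.exp_add]; simp; ring
    calc x * (1 - y ^ 2) ≤ x * (t * (ε * s)) := by
          apply mul_le_mul_of_nonneg_left _ hxp.le
          exact g1.trans (by gcongr)
      _ = 2 * ε * (t * s / 2 * x) := by ring
      _ ≤ 2 * ε * 1 := by gcongr
      _ = 2 * ε := by ring
  have f2 : |y ^ 2 - Real.exp (-t * δ')| * y ^ 2 ≤ ε * (1 - y ^ 2) := by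
    have lip : ∀ u v : ℝ, 0 ≤ u → 0 ≤ v → Real.exp (-u) - Real.exp (-v) ≤ |v - u| := by
      intro u v hu hv
      have : Real.exp (-u) - Real.exp (-v) = Real.exp (-u) * (1 - Real.exp (u - v)) := by
        rw [mul_sub, ← Real.exp_add]; ring_nf
      rw [this]
      have h3 : 1 - Real.exp (u - v) ≤ |v - u| := by
        linarith [Real.add_one_le_exp (u - v), le_abs_self (v - u)]
      have h4 : Real.exp (-u) ≤ 1 := Real.exp_le_one_iff.2 (by linarith)
      nlinarith [Real.exp_pos (-u), abs_nonneg (v - u)]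
    have g0 : |t * δ' - t * δ| ≤ ε * (t * δ) := by
      rw [← mul_sub, abs_mul, abs_of_pos ht]; nlinarith
    have g1 : |y ^ 2 - Real.exp (-t * δ')| ≤ ε * (t * δ) := by
      rw [← e5, abs_le]
      have l1 := lip (t * δ) (t * δ') (by positivity) (by positivity)
      have l2 := lip (t * δ') (t * δ) (by positivity) (by positivity)
      rw [abs_sub_comm] at l2
      simp only [neg_mul]
      constructor <;> linarith
    have g2 : t * δ * y ^ 2 ≤ 1 - y ^ 2 := by
      have : (t * δ + 1) * y ^ 2 ≤ Real.exp (t * δ) * y ^ 2 := by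
        gcongr; exact Real.add_one_le_exp _
      rw [← e5, ← Real.exp_add] at this
      simp at this
      rw [← e5]; simp; linarith
    calc _ ≤ ε * (t * δ) * y ^ 2 := by gcongr
      _ = ε * (t * δ * y ^ 2) := by ring
      _ ≤ _ := by gcongr
  rw [e1, e2, e3, e4]
  have key : x ^ 2 - 2 * (x ^ 2 * y ^ 2) + x ^ 2 * y ^ 2 * Real.exp (-t * δ') =
      x * (1 - y ^ 2) * (x * (1 - y ^ 2)) - x ^ 2 * ((y ^ 2 - Real.exp (-t * δ')) * y ^ 2) := by ring
  have hx1 : x * (1 + y) ≤ 2 * x := by nlinarith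
  have hy2 : 0 ≤ 1 - y ^ 2 := by nlinarith
  have hb : x * (1 - y ^ 2) ≤ 2 * (x - x * y) := by
    have : x * (1 - y ^ 2) = (x - x * y) * (1 + y) := by ring
    rw [this]
    have : 0 ≤ x - x * y := by nlinarith
    nlinarith
  have hε' : 0 ≤ ε * s := hs
  rw [key]
  refine (abs_sub _ _).trans ?_
  have hx1' : x ≤ 1 := by
    apply Real.exp_le_one_iff.2
    have : 0 < s := by
      by_contra h
      push Not at h
      nlinarith
    nlinarith
  have A : |x * (1 - y ^ 2) * (x * (1 - y ^ 2))| ≤ 4 * ε * (x - x * y) := by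
    rw [abs_of_nonneg (by positivity)]
    calc _ ≤ 2 * ε * (2 * (x - x * y)) := by gcongr
      _ = _ := by ring
  have Bd : |x ^ 2 * ((y ^ 2 - Real.exp (-t * δ')) * y ^ 2)| ≤ 2 * ε * (x - x * y) := by
    rw [abs_mul, abs_mul, abs_of_pos (pow_pos hxp 2), abs_of_pos (pow_pos hyp 2)]
    calc _ ≤ x ^ 2 * (ε * (1 - y ^ 2)) := by gcongr
      _ = x * ε * (x * (1 - y ^ 2)) := by ring
      _ ≤ 1 * ε * (2 * (x - x * y)) := by gcongr
      _ = _ := by ring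
  linarith

lemma aux_pos (p : Polynomial ℝ) (hp : 0 < p.leadingCoeff) : ∀ᶠ x in atTop, 0 < p.eval x := by
  by_cases h : 0 < p.degree
  · exact (p.tendsto_atTop_of_leadingCoeff_nonneg h hp.le).eventually_gt_atTop 0
  · have := Polynomial.eq_C_of_degree_le_zero (not_lt.1 h)
    rw [this] at hp ⊢
    simp at hp ⊢
    exact ⟨0, fun _ _ => hp⟩

lemma aux_asymp (s : Polynomial ℝ) (hdeg : 0 < s.natDegree) (hlead : 0 < s.leadingCoeff) :
    ∃ δ : Polynomial ℝ, (∀ x, δ.eval x = s.eval (x + 1) - s.eval x) ∧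
      (∀ᶠ x in atTop, 0 < δ.eval x) ∧
      (∀ ε > 0, ∀ᶠ x in atTop, δ.eval x ≤ ε * s.eval x) ∧
      (∀ ε > 0, ∀ᶠ x in atTop, |δ.eval (x + 1) - δ.eval x| ≤ ε * δ.eval x) := by
  have hs0 : s ≠ 0 := by rintro rfl; simp at hdeg
  have hst : Tendsto (fun x => s.eval x) atTop atTop :=
    s.tendsto_atTop_of_leadingCoeff_nonneg (Polynomial.natDegree_pos_iff_degree_pos.1 hdeg) hlead.le
  set δ := Polynomial.taylor 1 s - s with hδ
  have hev : ∀ x, δ.eval x = s.eval (x + 1) - s.eval x := by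
    intro x; rw [hδ, Polynomial.eval_sub, Polynomial.taylor_eval]
  have hnot : ¬ ∀ᶠ x in atTop, δ.eval x ≤ 0 := by
    intro h
    obtain ⟨N, hN⟩ := (tendsto_natCast_atTop_atTop.eventually h).exists_forall_of_atTop
    have hle : ∀ m : ℕ, s.eval ((N + m : ℕ) : ℝ) ≤ s.eval (N : ℝ) := by
      intro m
      induction m with
      | zero => simp
      | succ m ih =>
        have := hN (N + m) (by omega)
        rw [hev] at this
        rw [← Nat.add_assoc, Nat.cast_succ]
        linarith
    obtain ⟨n, hn, hn'⟩ := (((hst.comp tendsto_natCast_atTop_atTop).eventually_gt_atTop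
      (s.eval (N : ℝ))).and (eventually_ge_atTop N)).exists
    obtain ⟨m, rfl⟩ := Nat.exists_eq_add_of_le hn'
    exact absurd (hle m) (not_le.2 hn)
  have hlc : 0 < δ.leadingCoeff := by
    by_contra hcon
    rcases (not_lt.1 hcon).lt_or_eq with h | h
    · apply hnot
      have := aux_pos (-δ) (by simpa using h)
      filter_upwards [this] with x hx
      simp at hx; exact hx.le
    · apply hnot
      rw [Polynomial.leadingCoeff_eq_zero] at h
      simp [h]
  have hδ0 : δ ≠ 0 := by intro h; simp [h] at hlc
  have hpos := aux_pos δ hlc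
  refine ⟨δ, hev, hpos, ?_, ?_⟩
  · intro ε hε
    have hd : δ.degree < s.degree := Polynomial.degree_sub_lt_right (by simp) hs0 (by simp)
    filter_upwards [(Polynomial.isLittleO_atTop_of_degree_lt _ _ hd).bound hε, aux_pos s hlead]
      with x hx hx2
    rw [Real.norm_eq_abs, Real.norm_eq_abs, abs_of_pos hx2] at hx
    exact (le_abs_self _).trans hx
  · intro ε hε
    have hd : (Polynomial.taylor 1 δ - δ).degree < δ.degree :=
      Polynomial.degree_sub_lt_right (by simp) hδ0 (by simp)
    filter_upwards [(Polynomial.isLittleO_atTop_of_degree_lt _ _ hd).bound hε, hpos] with x hx hx2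
    rw [Real.norm_eq_abs, Real.norm_eq_abs, abs_of_pos hx2, Polynomial.eval_sub,
      Polynomial.taylor_eval] at hx
    exact hx

lemma aux_summable (s : Polynomial ℝ) (hdeg : 0 < s.natDegree) (hlead : 0 < s.leadingCoeff)
    (t : ℝ) (ht : 0 < t) : Summable (fun n : ℕ => Real.exp (-t * s.eval (n : ℝ))) := by
  have hX : (Polynomial.X : Polynomial ℝ).degree ≤ s.degree := by
    rw [Polynomial.degree_X, Polynomial.degree_eq_natDegree (by rintro rfl; simp at hdeg)]
    exact_mod_cast hdeg
  obtain ⟨c, hc, hb⟩ := (Polynomial.isBigO_atTop_of_degree_le _ _ hX).exists_pos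
  have hev := tendsto_natCast_atTop_atTop.eventually (hb.bound.and (aux_pos s hlead))
  have hsum : Summable (fun n : ℕ => Real.exp (n * (-(t / c)))) :=
    Real.summable_exp_nat_mul_iff.2 (by have := div_pos ht hc; linarith)
  refine hsum.of_norm_bounded_eventually_nat ?_
  filter_upwards [hev] with n hn
  obtain ⟨h1, h2⟩ := hn
  rw [Real.norm_eq_abs, Real.norm_eq_abs, abs_of_pos h2, Polynomial.eval_X, Nat.abs_cast] at h1
  rw [Real.norm_eq_abs, Real.abs_exp]
  apply Real.exp_le_exp.2
  have : (n : ℝ) * (t / c) ≤ t * s.eval (n : ℝ) := by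
    rw [mul_div_assoc', div_le_iff₀ hc]
    nlinarith
  linarith

lemma aux_main
    (s : Polynomial ℝ) (hdeg : 0 < s.natDegree) (hlead : 0 < s.leadingCoeff)
    (C : ℕ → ℂ) (k : ℕ) (hk : 0 < k)
    (hper : ∀ n : ℕ, C (n + k) = C n)
    (hmean : ∑ j ∈ Finset.range k, C j = 0) :
    Tendsto
      (fun t : ℝ =>
        ∑' n : ℕ, C n * ((Real.exp (-t * s.eval (n : ℝ)) : ℝ) : ℂ))
      (𝓝[>] 0)
      (𝓝 (-(1 / (k : ℂ)) * ∑ j ∈ Finset.Ico 1 k, (j : ℂ) * C j)) := by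
  set M := -(1 / (k : ℂ)) * ∑ j ∈ Finset.Ico 1 k, (j : ℂ) * C j with hM
  have hkC : (k : ℂ) ≠ 0 := by exact_mod_cast hk.ne'
  set S : ℕ → ℂ := fun n => ∑ i ∈ Finset.range n, C i with hS
  set V : ℕ → ℂ := fun n => ∑ i ∈ Finset.range n, (S (i + 1) - M) with hV
  have hSper : ∀ n, S (n + k) = S n := aux_per C k hper hmean
  have hI : ∑ j ∈ Finset.Ico 1 k, (j : ℂ) * C j = ∑ j ∈ Finset.range k, (j : ℂ) * C j := by
    rw [Finset.range_eq_Ico, Finset.sum_eq_sum_Ico_succ_bot hk]; simp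
  have hVper : ∀ n, V (n + k) = V n := by
    apply aux_per
    · intro n; rw [Nat.add_right_comm, hSper]
    · rw [Finset.sum_sub_distrib, aux_mean, hmean, hM, hI]
      simp; field_simp; ring
  obtain ⟨B₁, hB₁, hSB⟩ := aux_bdd S k hk hSper
  obtain ⟨B, hB, hVB⟩ := aux_bdd V k hk hVper
  obtain ⟨B₀, hB₀, hCB⟩ := aux_bdd C k hk hper
  obtain ⟨δ, hδ, hδpos, hδs, hδδ⟩ := aux_asymp s hdeg hlead
  set a : ℝ → ℕ → ℝ := fun t n => Real.exp (-t * s.eval (n : ℝ)) with ha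
  set D : ℝ → ℕ → ℝ := fun t n => |a t n - 2 * a t (n + 1) + a t (n + 2)| with hD
  have hasum : ∀ t > 0, Summable (a t) := fun t ht => aux_summable s hdeg hlead t ht
  -- main bound
  have bound : ∀ ε > 0, ∃ N : ℕ, ∀ t > 0,
      ‖(∑' n : ℕ, C n * (a t n : ℂ)) - M * (a t 0 : ℂ)‖ ≤
        B * (∑ n ∈ Finset.range N, D t n + 6 * ε) := by
    intro ε hε
    obtain ⟨N, hN⟩ := (tendsto_natCast_atTop_atTop.eventually
      (((hδpos.and (hδs ε hε)).and (hδδ ε hε)).and (aux_pos s hlead))).exists_forall_of_atTop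
    refine ⟨N, fun t ht => ?_⟩
    have hDb : ∀ n ≥ N, D t n ≤ 6 * ε * (Real.exp (-t * s.eval (n : ℝ) / 2) -
        Real.exp (-t * s.eval ((n + 1 : ℕ) : ℝ) / 2)) := by
      intro n hn
      obtain ⟨⟨⟨h1, h2⟩, h3⟩, h4⟩ := hN n hn
      obtain ⟨⟨⟨h1', -⟩, -⟩, -⟩ := hN (n + 1) (by omega)
      have := aux_diff t ε (s.eval (n : ℝ)) (δ.eval (n : ℝ)) (δ.eval ((n : ℝ) + 1)) ht hε.le h1
        (by simpa using h1') h3 h2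
      have e1 : s.eval (n : ℝ) + δ.eval (n : ℝ) = s.eval ((n + 1 : ℕ) : ℝ) := by
        rw [hδ]; push_cast; ring
      have e2 : s.eval ((n + 1 : ℕ) : ℝ) + δ.eval ((n : ℝ) + 1) = s.eval ((n + 2 : ℕ) : ℝ) := by
        rw [hδ]; push_cast; rw [add_assoc (n : ℝ) 1 1]; norm_num
      rw [e1, e2] at this
      exact this
    have hDsum : ∀ m : ℕ, ∑ n ∈ Finset.range (N + m), D t n ≤
        ∑ n ∈ Finset.range N, D t n + 6 * ε * (Real.exp (-t * s.eval (N : ℝ) / 2) -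
        Real.exp (-t * s.eval ((N + m : ℕ) : ℝ) / 2)) := by
      intro m
      induction m with
      | zero => simp
      | succ m ih =>
        rw [← Nat.add_assoc, Finset.sum_range_succ]
        have := hDb (N + m) (by omega)
        linarith
    have hDsum' : ∀ K ≥ N, ∑ n ∈ Finset.range K, D t n ≤ ∑ n ∈ Finset.range N, D t n + 6 * ε := by
      intro K hK
      obtain ⟨m, rfl⟩ := Nat.exists_eq_add_of_le hK
      refine (hDsum m).trans ?_
      have h1 : Real.exp (-t * s.eval (N : ℝ) / 2) ≤ 1 := by
        apply Real.exp_le_one_iff.2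
        have := (hN N le_rfl).2
        nlinarith
      have h2 := Real.exp_pos (-t * s.eval ((N + m : ℕ) : ℝ) / 2)
      have : 6 * ε * (Real.exp (-t * s.eval (N : ℝ) / 2) -
        Real.exp (-t * s.eval ((N + m : ℕ) : ℝ) / 2)) ≤ 6 * ε * 1 := by
        apply mul_le_mul_of_nonneg_left _ (by positivity)
        linarith
      linarith
    have hsumm : Summable (fun n => C n * (a t n : ℂ)) := by
      refine ((hasum t ht).mul_left B₀).of_norm_bounded (fun n => ?_)
      rw [norm_mul, Complex.norm_real, Real.norm_eq_abs, abs_of_pos (Real.exp_pos _)]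
      exact mul_le_mul_of_nonneg_right (hCB n) (Real.exp_pos _).le
    have haz : Tendsto (fun K => (a t K : ℂ)) atTop (𝓝 0) := by
      have := (Complex.continuous_ofReal.tendsto 0).comp (hasum t ht).tendsto_atTop_zero
      rw [Complex.ofReal_zero] at this
      exact this
    have haz1 : Tendsto (fun K => (a t (K + 1) : ℂ)) atTop (𝓝 0) :=
      haz.comp (tendsto_add_atTop_nat 1)
    have bz : ∀ (g : ℕ → ℂ) (b : ℝ) (u : ℕ → ℂ), (∀ n, ‖g n‖ ≤ b) → Tendsto u atTop (𝓝 0) →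
        Tendsto (fun n => g n * u n) atTop (𝓝 0) := by
      intro g b u hg hu
      have h0 : Tendsto (fun n => b * ‖u n‖) atTop (𝓝 0) := by simpa using hu.norm.const_mul b
      refine squeeze_zero_norm (fun n => ?_) h0
      rw [norm_mul]
      exact mul_le_mul_of_nonneg_right (hg n) (norm_nonneg _)
    have hbd : Tendsto (fun K => (S K - M) * (a t K : ℂ) + V K * ((a t K : ℂ) - a t (K + 1)))
        atTop (𝓝 0) := by
      have h1 := bz (fun K => S K - M) (B₁ + ‖M‖) _
        (fun n => (norm_sub_le _ _).trans (by linarith [hSB n])) haz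
      have h2 := bz V B _ hVB (haz.sub haz1 |>.congr (fun _ => rfl) |> fun h => by simpa using h)
      simpa using h1.add h2
    have hlim := ((hsumm.hasSum.tendsto_sum_nat.sub_const (M * (a t 0 : ℂ))).sub hbd).norm
    rw [sub_zero] at hlim
    refine le_of_tendsto hlim ?_
    filter_upwards [eventually_ge_atTop N] with K hK
    rw [aux_abel C (fun n => (a t n : ℂ)) M S V (by simp [hS]) (by simp [hV])
      (fun n => by simp [hS, Finset.sum_range_succ]) (fun n => by simp only [hV, Finset.sum_range_succ]) K]
    have hh : ∀ x y z : ℂ, x + y + z - x - y = z := by intros; ring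
    rw [hh]
    refine (norm_sum_le _ _).trans ?_
    refine le_trans ?_ (mul_le_mul_of_nonneg_left (hDsum' K hK) hB)
    rw [Finset.mul_sum]
    apply Finset.sum_le_sum
    intro n _
    rw [norm_mul]
    have : ‖(a t n : ℂ) - 2 * (a t (n + 1) : ℂ) + (a t (n + 2) : ℂ)‖ = D t n := by
      rw [hD]
      simp only
      rw [← Real.norm_eq_abs, ← Complex.norm_real]
      push_cast; rfl
    rw [this]
    exact mul_le_mul_of_nonneg_right (hVB _) (abs_nonneg _)
  -- continuity at zero
  have hacont : ∀ n, Continuous (fun t => a t n) := by intro n; simp only [ha]; fun_prop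
  have ha0 : ∀ n, a 0 n = 1 := by intro n; simp [ha]
  have hDlim : ∀ N : ℕ, Tendsto (fun t => ∑ n ∈ Finset.range N, D t n) (𝓝[>] 0) (𝓝 0) := by
    intro N
    have hc : Continuous (fun t => ∑ n ∈ Finset.range N, D t n) := by
      refine continuous_finsetSum _ (fun n _ => ?_)
      exact (((hacont n).sub ((hacont (n + 1)).const_mul 2)).add (hacont (n + 2))).abs
    have h0 := hc.tendsto 0
    have hz : ∑ n ∈ Finset.range N, D 0 n = 0 := by
      apply Finset.sum_eq_zero
      intro n _
      simp only [hD, ha0]; norm_num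
    rw [hz] at h0
    exact h0.mono_left nhdsWithin_le_nhds
  have hMlim : Tendsto (fun t => M * (a t 0 : ℂ)) (𝓝[>] 0) (𝓝 M) := by
    have hc : Continuous (fun t => M * (a t 0 : ℂ)) :=
      continuous_const.mul (Complex.continuous_ofReal.comp (hacont 0))
    have h0 := hc.tendsto 0
    simp only [ha0, Complex.ofReal_one, mul_one] at h0
    exact h0.mono_left nhdsWithin_le_nhds
  have hdiff : Tendsto (fun t => (∑' n : ℕ, C n * (a t n : ℂ)) - M * (a t 0 : ℂ))
      (𝓝[>] 0) (𝓝 0) := by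
    rw [Metric.tendsto_nhds]
    intro η hη
    obtain ⟨N, hN⟩ := bound (η / (12 * (B + 1))) (by positivity)
    have hl : Tendsto (fun t => B * (∑ n ∈ Finset.range N, D t n + 6 * (η / (12 * (B + 1)))))
        (𝓝[>] 0) (𝓝 (B * (0 + 6 * (η / (12 * (B + 1)))))) :=
      ((hDlim N).add_const _).const_mul B
    have hlt : B * (0 + 6 * (η / (12 * (B + 1)))) < η := by
      have : B * (0 + 6 * (η / (12 * (B + 1)))) = (B / (B + 1)) * (η / 2) := by field_simp; ring
      rw [this]
      have : B / (B + 1) ≤ 1 := by rw [div_le_one (by linarith)]; linarith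
      nlinarith
    filter_upwards [hl.eventually_lt_const hlt, self_mem_nhdsWithin] with t h1 h2
    rw [dist_zero_right]
    exact (hN t h2).trans_lt h1
  have hfin := hdiff.add hMlim
  simp only [sub_add_cancel, zero_add] at hfin
  exact hfin

/-- Theorem: if `s` is a real polynomial with positive degree and positive leading
coefficient, and `C : ℕ → ℂ` is periodic with period `k` and mean zero, then
`lim_{q→1⁻} Σ_{n≥0} C(n) q^{s(n)} = −(1/k)·Σ_{j=1}^{k−1} j·C(j)`. -/
theorem radial_limit_periodic_mean_zero
    (s : Polynomial ℝ) (hdeg : 0 < s.natDegree) (hlead : 0 < s.leadingCoeff)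
    (C : ℕ → ℂ) (k : ℕ) (hk : 0 < k)
    (hper : ∀ n : ℕ, C (n + k) = C n)
    (hmean : ∑ j ∈ Finset.range k, C j = 0) :
    Tendsto
      (fun q : ℝ =>
        ∑' n : ℕ, C n * ((q ^ (s.eval (n : ℝ)) : ℝ) : ℂ))
      (𝓝[Set.Ioo (0 : ℝ) 1] 1)
      (𝓝 (-(1 / (k : ℂ)) * ∑ j ∈ Finset.Ico 1 k, (j : ℂ) * C j)) := by
  have hlog : Tendsto (fun q : ℝ => -Real.log q) (𝓝[Set.Ioo (0 : ℝ) 1] 1) (𝓝[>] 0) := by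
    apply tendsto_nhdsWithin_of_tendsto_nhds_of_eventually_within
    · have : Tendsto (fun q : ℝ => -Real.log q) (𝓝 1) (𝓝 (-Real.log 1)) :=
        (Real.continuousAt_log (one_ne_zero)).neg.tendsto
      rw [Real.log_one, neg_zero] at this
      exact this.mono_left nhdsWithin_le_nhds
    · filter_upwards [self_mem_nhdsWithin] with q hq
      have := Real.log_neg hq.1 hq.2
      simpa using this
  refine ((aux_main s hdeg hlead C k hk hper hmean).comp hlog).congr' ?_
  filter_upwards [self_mem_nhdsWithin] with q hq
  simp only [Function.comp, neg_neg]
  refine tsum_congr (fun n => ?_)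
  rw [Real.rpow_def_of_pos hq.1]
end

section
/- Let C : ℕ → ℂ be a periodic function with period k and mean zero which is not identically zero. Then there exists A > 1 such that for every real a ≥ A, the limit lim_{q→1⁻} Σ_{n≥0} C(n) q^{a^n} (over q ∈ (0,1)) does not exist. -/
open Filter Topology

lemma rl_aux_bound (C : ℕ → ℂ) (M : ℝ) (hM : ∀ n, ‖C n‖ ≤ M) (b : ℝ) (hb : 2 ≤ b) (m : ℕ) :
    ‖(∑' n : ℕ, C n * ((Real.exp (-(b / (b^2)^m)) ^ ((b^2) ^ n) : ℝ) : ℂ))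
      - ∑ n ∈ Finset.range m, C n‖ ≤ 4 * M / b := by
  have hM0 : 0 ≤ M := (norm_nonneg _).trans (hM 0)
  have hb0 : 0 < b := by linarith
  have ha : 2 ≤ b^2 := by nlinarith
  have key : ∀ n : ℕ, Real.exp (-(b / (b^2)^m)) ^ ((b^2) ^ n : ℝ)
      = Real.exp (-(b / (b^2)^m * (b^2)^n)) := by
    intro n
    rw [← Real.exp_mul]; congr 1; ring
  have hpow : ∀ j : ℕ, ((b^2)^j)⁻¹ ≤ (1/2:ℝ)^j := by
    intro j
    rw [one_div, inv_pow]
    gcongr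
  have htail : ∀ j : ℕ, ‖C (j+m) * ((Real.exp (-(b / (b^2)^m)) ^ ((b^2) ^ (j+m)) : ℝ) : ℂ)‖
      ≤ M / b * (1/2:ℝ)^j := by
    intro j
    rw [key, norm_mul, Complex.norm_real, Real.norm_of_nonneg (Real.exp_pos _).le]
    have e : b / (b^2)^m * (b^2)^(j+m) = b * (b^2)^j := by
      rw [pow_add]; field_simp
    rw [e]
    have h1 : Real.exp (-(b * (b^2)^j)) ≤ (b * (b^2)^j)⁻¹ := by
      rw [Real.exp_neg]
      have : 0 < b * (b^2)^j := by positivity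
      gcongr
      linarith [Real.add_one_le_exp (b * (b^2)^j)]
    calc _ ≤ M * (b * (b^2)^j)⁻¹ := by
            apply mul_le_mul (hM _) h1 (Real.exp_pos _).le hM0
      _ = M / b * ((b^2)^j)⁻¹ := by rw [mul_inv]; ring
      _ ≤ _ := by gcongr; exact hpow j
  have hgs : Summable (fun j : ℕ => M / b * (1/2:ℝ)^j) := summable_geometric_two.mul_left _
  have hgt : ∑' j : ℕ, M / b * (1/2:ℝ)^j = M / b * 2 := by
    rw [tsum_mul_left, tsum_geometric_two]
  have hsum : Summable (fun n : ℕ => C n * ((Real.exp (-(b / (b^2)^m)) ^ ((b^2) ^ n) : ℝ) : ℂ)) := by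
    rw [← summable_nat_add_iff m]
    exact Summable.of_norm_bounded hgs htail
  rw [← hsum.sum_add_tsum_nat_add m, add_sub_right_comm, ← Finset.sum_sub_distrib]
  have hT := tsum_of_norm_bounded (hgt ▸ hgs.hasSum) htail
  have hF : ‖∑ n ∈ Finset.range m,
      (C n * ((Real.exp (-(b / (b^2)^m)) ^ ((b^2) ^ n) : ℝ) : ℂ) - C n)‖ ≤ M / b * 2 := by
    rw [← Finset.sum_range_reflect]
    calc _ ≤ ∑ j ∈ Finset.range m, M / b * (1/2:ℝ)^j := by
            apply norm_sum_le_of_le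
            intro j hj
            have hj := Finset.mem_range.1 hj
            obtain ⟨d, rfl⟩ : ∃ d, m = d + (j + 1) := ⟨m - (j+1), by omega⟩
            have hd : d + (j+1) - 1 - j = d := by omega
            rw [hd, key]
            have e : b / (b^2)^(d+(j+1)) * (b^2)^d = b⁻¹ * ((b^2)^j)⁻¹ := by
              rw [pow_add, pow_succ (b^2) j]; field_simp
            rw [e]
            set x := b⁻¹ * ((b^2)^j)⁻¹ with hx
            have hx0 : 0 ≤ x := by positivity
            have : C d * (Real.exp (-x) : ℂ) - C d = C d * ((Real.exp (-x) - 1 : ℝ) : ℂ) := by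
              push_cast; ring
            have h2 : |Real.exp (-x) - 1| ≤ x := by
              rw [abs_le]
              constructor
              · linarith [Real.add_one_le_exp (-x)]
              · have : Real.exp (-x) ≤ 1 := Real.exp_le_one_iff.2 (by linarith)
                linarith
            rw [this, norm_mul, Complex.norm_real, Real.norm_eq_abs]
            calc _ ≤ M * x := mul_le_mul (hM _) h2 (abs_nonneg _) hM0
              _ = M / b * ((b^2)^j)⁻¹ := by rw [hx]; ring
              _ ≤ _ := by gcongr; exact hpow j
      _ ≤ ∑' j : ℕ, M / b * (1/2:ℝ)^j := hgs.sum_le_tsum _ (fun _ _ => by positivity)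
      _ = _ := hgt
  calc _ ≤ M / b * 2 + M / b * 2 := norm_add_le_of_le hF hT
    _ = _ := by ring

/-- Theorem: let `C : ℕ → ℂ` be periodic with period `k`, mean zero, and not identically
zero.  Then there is `A > 1` such that for every real `a ≥ A` the limit
`lim_{q→1⁻} Σ_{n≥0} C(n) q^{a^n}` (over `q ∈ (0,1)`) does not exist. -/
theorem radial_limit_lacunary_divergence
    (C : ℕ → ℂ) (k : ℕ) (hk : 0 < k)
    (hper : ∀ n : ℕ, C (n + k) = C n)
    (hmean : ∑ j ∈ Finset.range k, C j = 0)
    (hne : ∃ n : ℕ, C n ≠ 0) :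
    ∃ A : ℝ, 1 < A ∧ ∀ a : ℝ, A ≤ a →
      ¬ ∃ L : ℂ,
        Tendsto
          (fun q : ℝ => ∑' n : ℕ, C n * ((q ^ (a ^ n) : ℝ) : ℂ))
          (𝓝[Set.Ioo (0 : ℝ) 1] 1) (𝓝 L) := by
  obtain ⟨n0, hn0⟩ := hne
  have hP : Function.Periodic C k := hper
  obtain ⟨M, hM⟩ : ∃ M : ℝ, ∀ n, ‖C n‖ ≤ M := by
    refine ⟨∑ j ∈ Finset.range k, ‖C j‖, fun n => ?_⟩
    rw [← hP.map_mod_nat n]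
    exact Finset.single_le_sum (f := fun j => ‖C j‖) (fun _ _ => norm_nonneg _)
      (Finset.mem_range.2 (Nat.mod_lt _ hk))
  have hM0 : 0 ≤ M := (norm_nonneg _).trans (hM 0)
  have hc : 0 < ‖C n0‖ := norm_pos_iff.2 hn0
  have hB : 2 ≤ 16 * M / ‖C n0‖ + 2 := by
    have : 0 ≤ 16 * M / ‖C n0‖ := by positivity
    linarith
  refine ⟨(16 * M / ‖C n0‖ + 2)^2, by nlinarith, ?_⟩
  rintro a ha ⟨L, hL⟩
  have ha0 : 0 ≤ a := le_trans (by positivity) ha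
  obtain ⟨b, hb, rfl⟩ : ∃ b, 16 * M / ‖C n0‖ + 2 ≤ b ∧ a = b^2 :=
    ⟨√a, Real.le_sqrt_of_sq_le ha, (Real.sq_sqrt ha0).symm⟩
  have hb2 : 2 ≤ b := hB.trans hb
  have hq : Tendsto (fun m : ℕ => Real.exp (-(b / (b^2)^m))) atTop (𝓝[Set.Ioo (0 : ℝ) 1] 1) := by
    rw [tendsto_nhdsWithin_iff]
    constructor
    · have h1 : Tendsto (fun m : ℕ => (b^2)^m) atTop atTop :=
        tendsto_pow_atTop_atTop_of_one_lt (by nlinarith)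
      have h2 := (h1.const_div_atTop b).neg
      have h3 := (Real.continuous_exp.tendsto _).comp h2
      simpa [Function.comp_def] using h3
    · refine Eventually.of_forall fun m => ⟨Real.exp_pos _, ?_⟩
      rw [Real.exp_lt_one_iff]
      have : 0 < b / (b^2)^m := by positivity
      linarith
  have hf := hL.comp hq
  have hsub : Tendsto (fun j : ℕ => n0 + j * k) atTop atTop :=
    tendsto_atTop_mono (fun j => by
      have := Nat.le_mul_of_pos_right j hk
      simp only [id]; omega) tendsto_id
  have hd := ((hf.comp ((tendsto_add_atTop_nat 1).comp hsub)).sub (hf.comp hsub)).norm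
  rw [sub_self, norm_zero] at hd
  have hlow : ∀ j : ℕ, ‖C n0‖ - 8 * M / b ≤
      ‖(∑' n : ℕ, C n * ((Real.exp (-(b / (b^2)^(n0 + j * k + 1))) ^ ((b^2) ^ n) : ℝ) : ℂ)) - (∑' n : ℕ, C n * ((Real.exp (-(b / (b^2)^(n0 + j * k))) ^ ((b^2) ^ n) : ℝ) : ℂ))‖ := fun j => by
    have h1 := rl_aux_bound C M hM b hb2 (n0 + j * k)
    have h2 := rl_aux_bound C M hM b hb2 (n0 + j * k + 1)
    rw [Finset.sum_range_succ] at h2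
    have hC : C (n0 + j * k) = C n0 := by
      simpa using hP.nat_mul j n0
    rw [hC] at h2
    generalize (∑' n : ℕ, C n * ((Real.exp (-(b / (b^2)^(n0 + j * k + 1))) ^ ((b^2) ^ n) : ℝ) : ℂ)) = x at *
    generalize (∑' n : ℕ, C n * ((Real.exp (-(b / (b^2)^(n0 + j * k))) ^ ((b^2) ^ n) : ℝ) : ℂ)) = y at *
    generalize ∑ n ∈ Finset.range (n0 + j * k), C n = s at *
    have e : C n0 = (x - y) + ((y - s) - (x - (s + C n0))) := by ring
    have h3 : ‖C n0‖ ≤ ‖x - y‖ + (‖y - s‖ + ‖x - (s + C n0)‖) := by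
      conv_lhs => rw [e]
      exact norm_add_le_of_le le_rfl (norm_sub_le _ _)
    have : 8 * M / b = 4 * M / b + 4 * M / b := by ring
    linarith
  have hfin := ge_of_tendsto' hd hlow
  have : 8 * M / b < ‖C n0‖ := by
    rw [div_lt_iff₀ (by linarith)]
    have := mul_le_mul_of_nonneg_left hb hc.le
    have e : ‖C n0‖ * (16 * M / ‖C n0‖ + 2) = 16 * M + 2 * ‖C n0‖ := by field_simp
    linarith
  linarith
end

section
/- Suppose s(n) is a real polynomial with positive degree d and positive leading coefficient, k ≥ 2 is an integer, and j is an integer with 0 ≤ j ≤ k−2. Then lim_{q→1⁻} Σ_{n≥0} (q^{s(nk+j)} − q^{s(nk+k−1)}) = (k−1−j)/k, where the limit is taken over q ∈ (0,1). -/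
open Filter Topology

lemma aux_exp (y : ℝ) (hy : 0 ≤ y) : 0 ≤ y - (1 - Real.exp (-y)) ∧ y - (1 - Real.exp (-y)) ≤ y ^ 2 := by
  constructor
  · have := Real.add_one_le_exp (-y); linarith
  · have h1 := Real.add_one_le_exp y
    have h2 : Real.exp (-y) * Real.exp y = 1 := by rw [← Real.exp_add]; simp
    have h3 := Real.exp_pos (-y)
    have h4 : Real.exp (-y) * (y + 1) ≤ 1 := by nlinarith
    have h5 : (y - 1 + Real.exp (-y) - y ^ 2) * (y + 1) ≤ 0 := by nlinarith [pow_nonneg hy 3]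
    by_contra hc
    push Not at hc
    nlinarith

lemma aux_term (t a a' b c ε : ℝ) (ht : 0 < t) (ha : 0 ≤ a) (hε : 0 < ε) (hε1 : ε ≤ 1)
    (hc0 : 0 ≤ c) (hc1 : c ≤ 1) (hD : 0 ≤ a' - a) (hDa : a' - a ≤ ε * a) (hB0 : 0 ≤ b - a)
    (hB : |(b - a) - c * (a' - a)| ≤ ε * (a' - a)) :
    |(Real.exp (-t * a) - Real.exp (-t * b)) - c * (Real.exp (-t * a) - Real.exp (-t * a'))|
      ≤ 40 * ε * (Real.exp (-t * a / 4) - Real.exp (-t * a' / 4)) := by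
  obtain ⟨D, rfl⟩ : ∃ D, a' = a + D := ⟨a' - a, by ring⟩
  obtain ⟨B, rfl⟩ : ∃ B, b = a + B := ⟨b - a, by ring⟩
  simp only [add_sub_cancel_left] at *
  have hB2 : B ≤ 2 * D := by have := (abs_le.1 hB).2; nlinarith
  have e1 : Real.exp (-t * (a + B)) = Real.exp (-t * a) * Real.exp (-(t * B)) := by
    rw [← Real.exp_add]; congr 1; ring
  have e2 : Real.exp (-t * (a + D)) = Real.exp (-t * a) * Real.exp (-(t * D)) := by
    rw [← Real.exp_add]; congr 1; ring
  obtain ⟨p1, p2⟩ := aux_exp (t * B) (by positivity)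
  obtain ⟨r1, r2⟩ := aux_exp (t * D) (by positivity)
  have key : |(1 - Real.exp (-(t * B))) - c * (1 - Real.exp (-(t * D)))|
      ≤ ε * (t * D) * (1 + 5 * (t * a)) := by
    have hBB : (t * B) ^ 2 ≤ 4 * (t * D) ^ 2 := by
      have : t * B ≤ 2 * (t * D) := by nlinarith
      have h0 : 0 ≤ t * B := by positivity
      nlinarith
    have hDD : (t * D) ^ 2 ≤ ε * (t * D) * (t * a) := by
      have : t * D * (t * D) ≤ t * D * (t * (ε * a)) := by gcongr
      nlinarith
    have h3 : |t * B - c * (t * D)| ≤ ε * (t * D) := by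
      have : t * B - c * (t * D) = t * (B - c * D) := by ring
      rw [this, abs_mul, abs_of_pos ht]
      nlinarith
    obtain ⟨h4, h5⟩ := abs_le.1 h3
    set X := Real.exp (-(t * B))
    set Y := Real.exp (-(t * D))
    have q1 : 0 ≤ c * (t * D - (1 - Y)) := mul_nonneg hc0 r1
    have q2 : c * (t * D - (1 - Y)) ≤ (t * D) ^ 2 := by nlinarith
    have hsq := sq_nonneg (t * D)
    rw [abs_le]
    constructor <;> nlinarith
  have e3 : (Real.exp (-t * a) - Real.exp (-t * (a + B))) - c * (Real.exp (-t * a) - Real.exp (-t * (a + D)))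
     = Real.exp (-t * a) * ((1 - Real.exp (-(t * B))) - c * (1 - Real.exp (-(t * D)))) := by
    rw [e1, e2]; ring
  rw [e3, abs_mul, abs_of_pos (Real.exp_pos _)]
  have hz : Real.exp (-t * a) * (1 + 5 * (t * a)) ≤ 10 * Real.exp (-(t * a / 2)) := by
    have h1 := Real.add_one_le_exp (t * a / 2)
    have h2 : Real.exp (-t * a) * Real.exp (t * a / 2) = Real.exp (-(t * a / 2)) := by
      rw [← Real.exp_add]; congr 1; ring
    rw [← h2]
    have := Real.exp_pos (-t * a)
    have hta : 0 ≤ t * a := by positivity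
    nlinarith
  have hw : Real.exp (-(t * a / 2)) ≤ Real.exp (-t * (a + D) / 4) := by
    apply Real.exp_le_exp.2
    have : D ≤ a := by nlinarith
    nlinarith
  have hv : t * D * Real.exp (-t * (a + D) / 4) ≤ 4 * (Real.exp (-t * a / 4) - Real.exp (-t * (a + D) / 4)) := by
    have h1 := Real.add_one_le_exp (t * D / 4)
    have h2 : Real.exp (-t * (a + D) / 4) * Real.exp (t * D / 4) = Real.exp (-t * a / 4) := by
      rw [← Real.exp_add]; congr 1; ring
    rw [← h2]
    have := Real.exp_pos (-t * (a + D) / 4)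
    nlinarith
  have hεtD : 0 ≤ ε * (t * D) := by positivity
  calc _ ≤ Real.exp (-t * a) * (ε * (t * D) * (1 + 5 * (t * a))) := by gcongr
    _ = ε * (t * D) * (Real.exp (-t * a) * (1 + 5 * (t * a))) := by ring
    _ ≤ ε * (t * D) * (10 * Real.exp (-t * (a + D) / 4)) := mul_le_mul_of_nonneg_left (by linarith) hεtD
    _ = 10 * ε * (t * D * Real.exp (-t * (a + D) / 4)) := by ring
    _ ≤ 10 * ε * (4 * (Real.exp (-t * a / 4) - Real.exp (-t * (a + D) / 4))) := by gcongr
    _ = _ := by ring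

lemma aux_tele (t : ℝ) (ht : 0 < t) (a : ℕ → ℝ) (ha : Tendsto a atTop atTop)
    (hm : ∀ n, a n ≤ a (n + 1)) :
    HasSum (fun n => Real.exp (-t * a n) - Real.exp (-t * a (n + 1))) (Real.exp (-t * a 0)) := by
  rw [hasSum_iff_tendsto_nat_of_nonneg]
  · simp_rw [Finset.sum_range_sub']
    have : Tendsto (fun n => Real.exp (-t * a n)) atTop (𝓝 0) := by
      apply Real.tendsto_exp_atBot.comp
      exact ha.const_mul_atTop_of_neg (by linarith)
    simpa using this.const_sub (Real.exp (-t * a 0))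
  · intro n
    have : Real.exp (-t * a (n+1)) ≤ Real.exp (-t * a n) := by
      apply Real.exp_le_exp.2
      nlinarith [hm n]
    linarith

lemma aux_tail (t c ε : ℝ) (a b : ℕ → ℝ) (ht : 0 < t) (hε : 0 < ε) (hε1 : ε ≤ 1)
    (hc0 : 0 ≤ c) (hc1 : c ≤ 1) (hat : Tendsto a atTop atTop)
    (ha : ∀ n, 0 ≤ a n) (hD : ∀ n, 0 ≤ a (n+1) - a n) (hDa : ∀ n, a (n+1) - a n ≤ ε * a n)
    (hB0 : ∀ n, 0 ≤ b n - a n)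
    (hB : ∀ n, |(b n - a n) - c * (a (n+1) - a n)| ≤ ε * (a (n+1) - a n)) :
    Summable (fun n => Real.exp (-t * a n) - Real.exp (-t * b n)) ∧
    |(∑' n, (Real.exp (-t * a n) - Real.exp (-t * b n))) - c * Real.exp (-t * a 0)| ≤ 40 * ε := by
  have hm : ∀ n, a n ≤ a (n+1) := fun n => by linarith [hD n]
  have S1 := (aux_tele t ht a hat hm).mul_left c
  have S2 := (aux_tele (t/4) (by positivity) a hat hm).mul_left (40 * ε)
  have hle : ∀ n, ‖(Real.exp (-t * a n) - Real.exp (-t * b n)) - c * (Real.exp (-t * a n) - Real.exp (-t * a (n+1)))‖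
      ≤ 40 * ε * (Real.exp (-(t/4) * a n) - Real.exp (-(t/4) * a (n+1))) := by
    intro n
    have := aux_term t (a n) (a (n+1)) (b n) c ε ht (ha n) hε hε1 hc0 hc1 (hD n) (hDa n) (hB0 n) (hB n)
    rw [Real.norm_eq_abs]
    convert this using 5 <;> ring
  have hs := Summable.of_norm_bounded S2.summable hle
  have hbd := tsum_of_norm_bounded S2 hle
  have hsv : Summable (fun n => Real.exp (-t * a n) - Real.exp (-t * b n)) := by
    simpa using hs.add S1.summable
  refine ⟨hsv, ?_⟩
  rw [hsv.tsum_sub S1.summable, S1.tsum_eq, Real.norm_eq_abs] at hbd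
  refine hbd.trans ?_
  have : Real.exp (-(t/4) * a 0) ≤ 1 := by
    apply Real.exp_le_one_iff.2
    nlinarith [mul_nonneg ht.le (ha 0)]
  nlinarith

lemma aux_main_s4 (c : ℝ) (a b : ℕ → ℝ) (hc0 : 0 < c) (hc1 : c ≤ 1) (hat : Tendsto a atTop atTop)
    (hD : ∀ᶠ n in atTop, 0 < a (n+1) - a n)
    (hDa : Tendsto (fun n => (a (n+1) - a n) / a n) atTop (𝓝 0))
    (hB : Tendsto (fun n => (b n - a n) / (a (n+1) - a n)) atTop (𝓝 c)) :
    Tendsto (fun q : ℝ => ∑' n, (q ^ a n - q ^ b n)) (𝓝[Set.Ioo (0 : ℝ) 1] 1) (𝓝 c) := by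
  rw [Metric.tendsto_nhds]
  intro δ hδ
  obtain ⟨ε, hε, hε1, hεc, hεδ⟩ : ∃ ε : ℝ, 0 < ε ∧ ε ≤ 1 ∧ ε ≤ c ∧ 40 * ε ≤ δ / 2 := by
    refine ⟨min (min 1 c) (δ / 80), by positivity, ?_, ?_, ?_⟩
    · exact (min_le_left _ _).trans (min_le_left _ _)
    · exact (min_le_left _ _).trans (min_le_right _ _)
    · have := min_le_right (min 1 c) (δ / 80); linarith
  have ev : ∀ᶠ n in atTop, 0 < a n ∧ 0 < a (n+1) - a n ∧ (a (n+1) - a n) / a n < ε ∧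
      |(b n - a n) / (a (n+1) - a n) - c| < ε := by
    filter_upwards [hat.eventually_gt_atTop 0, hD, hDa.eventually_lt_const hε,
      (Metric.tendsto_nhds.1 hB) ε hε] with n h1 h2 h3 h4
    exact ⟨h1, h2, h3, h4⟩
  obtain ⟨N, hN⟩ := eventually_atTop.1 ev
  have hfin : Tendsto (fun q : ℝ => ∑ n ∈ Finset.range N, (q ^ a n - q ^ b n) + c * q ^ a N)
      (𝓝[Set.Ioo (0 : ℝ) 1] 1) (𝓝 c) := by
    have hp : ∀ x : ℝ, Tendsto (fun q : ℝ => q ^ x) (𝓝[Set.Ioo (0 : ℝ) 1] 1) (𝓝 1) := by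
      intro x
      have := (Real.continuousAt_rpow_const 1 x (Or.inl one_ne_zero)).tendsto
      rw [Real.one_rpow] at this
      exact this.mono_left nhdsWithin_le_nhds
    have h1 := tendsto_finsetSum (Finset.range N) (fun n _ => (hp (a n)).sub (hp (b n)))
    simpa using h1.add ((hp (a N)).const_mul c)
  filter_upwards [(Metric.tendsto_nhds.1 hfin) (δ/2) (by positivity), self_mem_nhdsWithin] with q hq hq01
  obtain ⟨hq0, hq1⟩ := hq01
  have ht : 0 < -Real.log q := by have := Real.log_neg hq0 hq1; linarith
  have hqe : ∀ x : ℝ, q ^ x = Real.exp (-(-Real.log q) * x) := by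
    intro x; rw [Real.rpow_def_of_pos hq0, neg_neg]
  have hN' : ∀ n, _ := fun n => hN (n + N) (Nat.le_add_left N n)
  have T := aux_tail (-Real.log q) c ε (fun n => a (n + N)) (fun n => b (n + N)) ht hε hε1 hc0.le hc1
    ((tendsto_add_atTop_iff_nat N).2 hat) (fun n => (hN' n).1.le)
    (fun n => by
      have := (hN' n).2.1
      rw [show n + N + 1 = n + 1 + N by ring] at this
      exact this.le)
    (fun n => by
      obtain ⟨h1, h2, h3, h4⟩ := hN' n
      rw [show n + N + 1 = n + 1 + N by ring] at h3
      exact ((div_lt_iff₀ h1).1 h3).le)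
    (fun n => by
      obtain ⟨h1, h2, h3, h4⟩ := hN' n
      have h5 := (abs_lt.1 h4).1
      have h6 : 0 < (b (n+N) - a (n+N)) / (a (n+N+1) - a (n+N)) := by linarith
      exact ((div_pos_iff_of_pos_right h2).1 h6).le)
    (fun n => by
      obtain ⟨h1, h2, h3, h4⟩ := hN' n
      have h7 : (b (n+N) - a (n+N)) - c * (a (n+N+1) - a (n+N)) =
         ((b (n+N) - a (n+N)) / (a (n+N+1) - a (n+N)) - c) * (a (n+N+1) - a (n+N)) := by
        field_simp
      have h8 : |(b (n+N) - a (n+N)) - c * (a (n+N+1) - a (n+N))| ≤ ε * (a (n+N+1) - a (n+N)) := by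
        rw [h7, abs_mul, abs_of_pos h2]
        gcongr
      rw [show n + N + 1 = n + 1 + N by ring] at h8
      exact h8)
  simp only [← hqe, zero_add] at T
  obtain ⟨T1, T2⟩ := T
  have hs : Summable (fun n => q ^ a n - q ^ b n) := (summable_nat_add_iff N).1 T1
  rw [← hs.sum_add_tsum_nat_add N]
  rw [Real.dist_eq] at hq ⊢
  rw [abs_lt] at hq ⊢
  rw [abs_le] at T2
  constructor <;> linarith [hq.1, hq.2, T2.1, T2.2]

lemma aux_poly (s : Polynomial ℝ) (hdeg : 0 < s.natDegree) (h : ℝ) :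
    Tendsto (fun x : ℝ => (s.eval (x + h) - s.eval x) / x ^ (s.natDegree - 1)) atTop
      (𝓝 (h * (s.natDegree * s.leadingCoeff))) := by
  obtain ⟨m, hm⟩ : ∃ m, s.natDegree = m + 1 := ⟨s.natDegree - 1, by omega⟩
  set P := Polynomial.taylor h s - s with hP
  have hPe : ∀ x, P.eval x = s.eval (x + h) - s.eval x := by
    intro x; simp [hP, Polynomial.taylor_eval]
  have hcm1 : P.coeff (m+1) = 0 := by
    have := Polynomial.coeff_taylor_natDegree (f := s) (r := h)
    rw [hm] at this
    simp [hP, this, Polynomial.leadingCoeff, hm]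
  have hPdeg : P.natDegree ≤ m := by
    have h1 : P.natDegree ≤ m + 1 := by
      refine (Polynomial.natDegree_sub_le _ _).trans ?_
      simp [Polynomial.natDegree_taylor, hm]
    by_contra hc
    have h2 : P.natDegree = m + 1 := by omega
    have h3 : P.leadingCoeff = 0 := by rw [Polynomial.leadingCoeff, h2, hcm1]
    rw [Polynomial.leadingCoeff_eq_zero] at h3
    rw [h3] at h2; simp at h2
  have hcm : P.coeff m = h * (s.natDegree * s.leadingCoeff) := by
    have hd : (Polynomial.hasseDeriv m s).natDegree < 2 := by
      have := Polynomial.natDegree_hasseDeriv_le s m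
      omega
    rw [hP, Polynomial.coeff_sub, Polynomial.taylor_coeff, Polynomial.eval_eq_sum_range' hd]
    simp only [Finset.sum_range_succ, Finset.sum_range_zero, Polynomial.hasseDeriv_coeff]
    rw [Polynomial.leadingCoeff, hm]
    have : (1 + m).choose m = m + 1 := by rw [add_comm, Nat.choose_succ_self_right]
    rw [this, add_comm 1 m]
    simp
    ring
  simp only [hm, Nat.add_sub_cancel] at hcm ⊢
  rw [← hcm]
  have hX : ∀ x : ℝ, x ^ m = (Polynomial.X ^ m : Polynomial ℝ).eval x := by simp
  simp_rw [← hPe, hX]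
  rcases hPdeg.lt_or_eq with hl | he
  · rw [Polynomial.coeff_eq_zero_of_natDegree_lt hl]
    apply Polynomial.div_tendsto_atTop_zero_of_degree_lt
    rw [Polynomial.degree_X_pow]
    exact Polynomial.degree_le_natDegree.trans_lt (by exact_mod_cast hl)
  · by_cases hP0 : P = 0
    · simp [hP0]
    have := Polynomial.div_tendsto_atTop_leadingCoeff_div_of_degree_eq P (Polynomial.X ^ m) (by
      rw [Polynomial.degree_X_pow, Polynomial.degree_eq_natDegree hP0, he])
    simpa [Polynomial.leadingCoeff, he] using this

/-- If `s` is a real polynomial with positive degree and positive leading coefficient,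
`k ≥ 2` and `0 ≤ j ≤ k − 2`, then
`lim_{q→1⁻} Σ_{n≥0} (q^{s(nk+j)} − q^{s(nk+k−1)}) = (k−1−j)/k`. -/
theorem radial_limit_arith_progression_difference
    (s : Polynomial ℝ) (hdeg : 0 < s.natDegree) (hlead : 0 < s.leadingCoeff)
    (k j : ℕ) (hk : 2 ≤ k) (hj : j ≤ k - 2) :
    Tendsto
      (fun q : ℝ =>
        ∑' n : ℕ,
          (q ^ (s.eval ((n * k + j : ℕ) : ℝ)) - q ^ (s.eval ((n * k + k - 1 : ℕ) : ℝ))))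
      (𝓝[Set.Ioo (0 : ℝ) 1] 1) (𝓝 (((k : ℝ) - 1 - (j : ℝ)) / (k : ℝ))) := by
  have hjk : (j : ℝ) + 2 ≤ k := by exact_mod_cast (by omega : j + 2 ≤ k)
  have hj0 : (0 : ℝ) ≤ j := j.cast_nonneg
  have hk0 : (0 : ℝ) < k := by linarith
  have hx : Tendsto (fun n : ℕ => ((n * k + j : ℕ) : ℝ)) atTop atTop := by
    apply tendsto_natCast_atTop_atTop.comp
    apply tendsto_atTop_mono (f := fun n => n) _ tendsto_id
    intro n; nlinarith
  have hL : 0 < (s.natDegree : ℝ) * s.leadingCoeff := by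
    have : (0 : ℝ) < s.natDegree := by exact_mod_cast hdeg
    positivity
  have hstep : ∀ n : ℕ, (((n + 1) * k + j : ℕ) : ℝ) = ((n * k + j : ℕ) : ℝ) + k := by
    intro n; push_cast; ring
  have hbs : ∀ n : ℕ, ((n * k + k - 1 : ℕ) : ℝ) = ((n * k + j : ℕ) : ℝ) + (k - 1 - j) := by
    intro n
    rw [Nat.cast_sub (by nlinarith [Nat.zero_le (n * k)])]; push_cast; ring
  have hDp := aux_poly s hdeg k
  have hBp := aux_poly s hdeg (k - 1 - j)
  have hpow : ∀ᶠ x : ℝ in atTop, 0 < x ^ (s.natDegree - 1) := by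
    filter_upwards [eventually_gt_atTop 0] with x hx
    positivity
  have hdeg' : 0 < s.degree := Polynomial.natDegree_pos_iff_degree_pos.1 hdeg
  apply aux_main_s4
  · apply div_pos <;> linarith
  · rw [div_le_one hk0]; linarith
  · exact (Polynomial.tendsto_atTop_of_leadingCoeff_nonneg s hdeg' hlead.le).comp hx
  · simp_rw [hstep]
    apply hx.eventually (p := fun x : ℝ => 0 < s.eval (x + k) - s.eval x)
    filter_upwards [hpow, hDp.eventually_const_lt (show (0:ℝ) < _ by positivity)] with x h1 h2
    exact (div_pos_iff_of_pos_right h1).1 h2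
  · simp_rw [hstep]
    have h1 : Tendsto (fun x : ℝ => (s.eval (x + k) - s.eval x) / s.eval x) atTop (𝓝 0) := by
      have h2 : Tendsto (fun x : ℝ => (Polynomial.X ^ (s.natDegree - 1) : Polynomial ℝ).eval x / s.eval x) atTop (𝓝 0) := by
        apply Polynomial.div_tendsto_atTop_zero_of_degree_lt
        rw [Polynomial.degree_X_pow, Polynomial.degree_eq_natDegree (by rintro rfl; simp at hdeg)]
        exact_mod_cast (by omega : s.natDegree - 1 < s.natDegree)
      have h3 := hDp.mul h2
      rw [mul_zero] at h3
      refine h3.congr' ?_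
      filter_upwards [hpow] with x hx
      simp only [Polynomial.eval_pow, Polynomial.eval_X]
      field_simp
    exact h1.comp hx
  · simp_rw [hstep, hbs]
    have h3 := hBp.div hDp (by positivity)
    rw [mul_div_mul_right _ _ hL.ne'] at h3
    have h1 : Tendsto (fun x : ℝ => (s.eval (x + (k - 1 - j)) - s.eval x) / (s.eval (x + k) - s.eval x)) atTop
        (𝓝 (((k : ℝ) - 1 - (j : ℝ)) / (k : ℝ))) := by
      refine h3.congr' ?_
      filter_upwards [hpow] with x hx
      simp only [Pi.div_apply]
      rw [div_div_div_cancel_right₀ hx.ne']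
    exact h1.comp hx
end

section
/- Suppose s(n) is a real polynomial of degree d ≥ 1 with leading coefficient a_d > 0, k ≥ 2 is an integer, and j is an integer with 0 ≤ j ≤ k−2. Define x(n) = Σ_{l=0}^{n−1} (s(lk + k − 1) − s(lk + j)) and y(n) = s(nk + j) − x(n). Then lim_{n→∞} y(n)/n^d = a_d · k^{d−1} · (j + 1). -/
open Filter Topology

theorem aux_pow (i d : ℕ) (h : i ≤ d) :
    Tendsto (fun n : ℕ => (n : ℝ) ^ i / (n : ℝ) ^ d) atTop (𝓝 (if i = d then 1 else 0)) := by
  split_ifs with hi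
  · subst hi
    refine tendsto_const_nhds.congr' ?_
    filter_upwards [eventually_gt_atTop 0] with n hn
    have : (n : ℝ) ≠ 0 := by positivity
    field_simp
  · exact (tendsto_pow_div_pow_atTop_zero (𝕜 := ℝ) (lt_of_le_of_ne h hi)).comp
      tendsto_natCast_atTop_atTop

theorem aux_sum (g : ℕ → ℕ → ℝ) (c : ℕ → ℝ) (d : ℕ) (L : ℝ)
    (hf : ∀ i ≤ d, Tendsto (g i) atTop (𝓝 (if i = d then L else 0))) :
    Tendsto (fun n => ∑ i ∈ Finset.range (d + 1), c i * g i n) atTop (𝓝 (c d * L)) := by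
  have h := tendsto_finsetSum (Finset.range (d + 1))
    (fun i hi => (hf i (by simpa [Nat.lt_succ_iff] using hi)).const_mul (c i))
  simpa using h

theorem aux_poly_s6 (p : Polynomial ℝ) (d : ℕ) (h : p.natDegree ≤ d) :
    Tendsto (fun n : ℕ => p.eval (n : ℝ) / (n : ℝ) ^ d) atTop (𝓝 (p.coeff d)) := by
  have := aux_sum (fun i n => (n : ℝ) ^ i / (n : ℝ) ^ d) p.coeff d 1
    (fun i hi => aux_pow i d hi)
  rw [mul_one] at this
  refine this.congr fun n => ?_
  rw [Polynomial.eval_eq_sum_range' (Nat.lt_succ_of_le h), Finset.sum_div]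
  exact Finset.sum_congr rfl fun i _ => by ring

theorem aux_faul (i d : ℕ) (h : i ≤ d) :
    Tendsto (fun n : ℕ => (∑ l ∈ Finset.range n, (l : ℝ) ^ i) / (n : ℝ) ^ (d + 1)) atTop
      (𝓝 (if i = d then 1 / ((d : ℝ) + 1) else 0)) := by
  have key : ∀ n : ℕ, (∑ l ∈ Finset.range n, (l : ℝ) ^ i) =
      ∑ m ∈ Finset.range (i + 1),
        (bernoulli m : ℝ) * ((i + 1).choose m) * (n : ℝ) ^ (i + 1 - m) / (i + 1) := by
    intro n
    have := congrArg (fun q : ℚ => (q : ℝ)) (sum_range_pow n i)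
    simpa using this
  have h1 := tendsto_finsetSum (Finset.range (i + 1)) (fun m _ =>
    (aux_pow (i + 1 - m) (d + 1) (by omega)).const_mul
      ((bernoulli m : ℝ) * ((i + 1).choose m) / (i + 1)))
  have h2 : (∑ m ∈ Finset.range (i + 1), ((bernoulli m : ℝ) * ((i + 1).choose m) / (i + 1)) *
      (if i + 1 - m = d + 1 then (1 : ℝ) else 0)) = (if i = d then 1 / ((d : ℝ) + 1) else 0) := by
    rw [Finset.sum_eq_single 0]
    · by_cases hi : i = d <;> simp [hi]
    · intro m _ hm
      rw [if_neg (by omega), mul_zero]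
    · simp
  rw [h2] at h1
  refine h1.congr fun n => ?_
  rw [key, Finset.sum_div]
  exact Finset.sum_congr rfl fun m _ => by ring

theorem aux_polysum (p : Polynomial ℝ) (d : ℕ) (h : p.natDegree ≤ d) :
    Tendsto (fun n : ℕ => (∑ l ∈ Finset.range n, p.eval (l : ℝ)) / (n : ℝ) ^ (d + 1)) atTop
      (𝓝 (p.coeff d * (1 / ((d : ℝ) + 1)))) := by
  have := aux_sum 
    (fun i n => (∑ l ∈ Finset.range n, (l : ℝ) ^ i) / (n : ℝ) ^ (d + 1)) p.coeff d
    (1 / ((d : ℝ) + 1)) (fun i hi => aux_faul i d hi)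
  refine this.congr fun n => ?_
  simp_rw [Polynomial.eval_eq_sum_range' (Nat.lt_succ_of_le h)]
  rw [Finset.sum_comm, Finset.sum_div]
  exact Finset.sum_congr rfl fun i _ => by rw [← Finset.mul_sum]; ring

theorem aux_taylor_top (t : Polynomial ℝ) (d : ℕ) (h : t.natDegree ≤ d) (r : ℝ) :
    (Polynomial.taylor r t).coeff d = t.coeff d := by
  rw [Polynomial.taylor_coeff, Polynomial.eval_eq_sum_range' (n := 1)]
  · simp [Polynomial.hasseDeriv_coeff]
  · have := Polynomial.natDegree_hasseDeriv_le t d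
    omega

theorem aux_taylor_sub (t : Polynomial ℝ) (e : ℕ) (h : t.natDegree ≤ e + 1) (r : ℝ) :
    (Polynomial.taylor r t).coeff e = t.coeff e + (e + 1) * t.coeff (e + 1) * r := by
  rw [Polynomial.taylor_coeff, Polynomial.eval_eq_sum_range' (n := 2)]
  · simp [Polynomial.hasseDeriv_coeff, Finset.sum_range_succ, add_comm 1 e]
  · have := Polynomial.natDegree_hasseDeriv_le t e
    omega

/-- With `x(n) = Σ_{l=0}^{n−1} (s(lk+k−1) − s(lk+j))` and `y(n) = s(nk+j) − x(n)`,
one has `lim_{n→∞} y(n)/n^d = a_d · k^{d−1} · (j+1)` where `d = deg s` and `a_d` is the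
leading coefficient of `s`. -/
theorem asymptotics_of_y
    (s : Polynomial ℝ) (d : ℕ) (hd : s.natDegree = d) (hdeg : 1 ≤ d)
    (hlead : 0 < s.leadingCoeff)
    (k j : ℕ) (hk : 2 ≤ k) (hj : j ≤ k - 2)
    (x y : ℕ → ℝ)
    (hx : ∀ n : ℕ, x n =
      ∑ l ∈ Finset.range n,
        (s.eval ((l * k + k - 1 : ℕ) : ℝ) - s.eval ((l * k + j : ℕ) : ℝ)))
    (hy : ∀ n : ℕ, y n = s.eval ((n * k + j : ℕ) : ℝ) - x n) :
    Tendsto (fun n : ℕ => y n / (n : ℝ) ^ d) atTop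
      (𝓝 (s.leadingCoeff * (k : ℝ) ^ (d - 1) * ((j : ℝ) + 1))) := by
  obtain ⟨e, rfl⟩ : ∃ e, d = e + 1 := ⟨d - 1, by omega⟩
  have hk0 : (k : ℝ) ≠ 0 := by
    have : k ≠ 0 := by omega
    exact_mod_cast this
  set t : Polynomial ℝ := s.comp (Polynomial.C (k : ℝ) * Polynomial.X) with ht
  have htc : ∀ m, t.coeff m = s.coeff m * (k : ℝ) ^ m := fun m => by
    rw [ht, Polynomial.comp_C_mul_X_coeff]
  have htd : t.natDegree ≤ e + 1 := by
    rw [Polynomial.natDegree_le_iff_coeff_eq_zero]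
    intro m hm
    rw [htc, Polynomial.coeff_eq_zero_of_natDegree_lt (by omega), zero_mul]
  have hev : ∀ l b : ℕ, s.eval ((l * k + b : ℕ) : ℝ) =
      (Polynomial.taylor ((b : ℝ) / k) t).eval (l : ℝ) := by
    intro l b
    rw [Polynomial.taylor_eval, ht, Polynomial.eval_comp]
    congr 1
    simp
    field_simp
  set p := Polynomial.taylor (((k - 1 : ℕ) : ℝ) / k) t - Polynomial.taylor ((j : ℝ) / k) t with hp
  have hpd : p.natDegree ≤ e := by
    rw [Polynomial.natDegree_le_iff_coeff_eq_zero]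
    intro m hm
    have hm' : t.natDegree ≤ m := by omega
    rw [hp, Polynomial.coeff_sub, aux_taylor_top t m hm', aux_taylor_top t m hm', sub_self]
  have h1 := aux_poly_s6 (Polynomial.taylor ((j : ℝ) / k) t) (e + 1)
    (by rw [Polynomial.natDegree_taylor]; exact htd)
  have h2 := h1.sub (aux_polysum p e hpd)
  have hlc : s.coeff (e + 1) = s.leadingCoeff := by rw [Polynomial.leadingCoeff, hd]
  have hlim : (Polynomial.taylor ((j : ℝ) / k) t).coeff (e + 1) -
      p.coeff e * (1 / ((e : ℝ) + 1)) =
      s.leadingCoeff * (k : ℝ) ^ (e + 1 - 1) * ((j : ℝ) + 1) := by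
    have he : (e : ℝ) + 1 ≠ 0 := by positivity
    rw [hp, Polynomial.coeff_sub, aux_taylor_top t _ htd, aux_taylor_sub t e htd,
      aux_taylor_sub t e htd, htc (e + 1), hlc, Nat.cast_sub (by omega : 1 ≤ k),
      Nat.add_sub_cancel]
    push_cast
    field_simp
    ring
  rw [hlim] at h2
  refine h2.congr fun n => ?_
  rw [hy, hx, hev n j, sub_div]
  congr 2
  refine Finset.sum_congr rfl fun l _ => ?_
  rw [Nat.add_sub_assoc (by omega : 1 ≤ k), hev, hev, hp, Polynomial.eval_sub]
end

section
/- Let C : ℕ → ℂ be a periodic function with period k and mean zero, let s(n) be a real polynomial with positive degree and positive leading coefficient, and let q ∈ (0,1). Then Σ_{n≥0} C(n) q^{s(n)} = Σ_{j=0}^{k−2} C(j) · Σ_{n≥0} (q^{s(nk+j)} − q^{s(nk+k−1)}), all series converging absolutely. -/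
theorem summable_aux (s : Polynomial ℝ) (hdeg : 0 < s.natDegree) (hlead : 0 < s.leadingCoeff)
    (q : ℝ) (hq : q ∈ Set.Ioo (0 : ℝ) 1) :
    Summable (fun n : ℕ => q ^ (s.eval (n : ℝ))) := by
  have hd : 0 < s.degree := Polynomial.natDegree_pos_iff_degree_pos.1 hdeg
  have hle : (Polynomial.X : Polynomial ℝ).degree ≤ s.degree := by
    rw [Polynomial.degree_X]
    rw [Polynomial.degree_eq_natDegree (Polynomial.leadingCoeff_ne_zero.1 hlead.ne')]
    exact_mod_cast hdeg
  have ht := s.tendsto_atTop_of_leadingCoeff_nonneg hd hlead.le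
  obtain ⟨K, hK, hO⟩ := (Polynomial.isBigO_atTop_of_degree_le _ _ hle).exists_pos
  have hev := (hO.bound.and (ht.eventually_ge_atTop 0))
  have hev2 := (tendsto_natCast_atTop_atTop (R := ℝ)).eventually hev
  have hr0 : 0 < q ^ K⁻¹ := Real.rpow_pos_of_pos hq.1 _
  have hr1 : q ^ K⁻¹ < 1 := Real.rpow_lt_one hq.1.le hq.2 (inv_pos.2 hK)
  refine summable_of_isBigO_nat (summable_geometric_of_lt_one hr0.le hr1) ?_
  refine Asymptotics.IsBigO.of_bound 1 ?_
  filter_upwards [hev2] with n hn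
  obtain ⟨h1, h2⟩ := hn
  rw [Polynomial.eval_X, Real.norm_of_nonneg h2, Real.norm_of_nonneg (Nat.cast_nonneg n)] at h1
  rw [Real.norm_of_nonneg (Real.rpow_nonneg hq.1.le _), one_mul,
    Real.norm_of_nonneg (pow_nonneg hr0.le _), ← Real.rpow_natCast, ← Real.rpow_mul hq.1.le]
  refine Real.rpow_le_rpow_of_exponent_ge hq.1 hq.2.le ?_
  rw [inv_mul_le_iff₀ hK]
  exact h1

/-- If `C : ℕ → ℂ` is periodic with period `k` and mean zero, `s` is a real polynomial
with positive degree and positive leading coefficient, and `q ∈ (0,1)`, then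
`Σ_{n≥0} C(n) q^{s(n)} = Σ_{j=0}^{k−2} C(j) · Σ_{n≥0} (q^{s(nk+j)} − q^{s(nk+k−1)})`,
all series converging absolutely. -/
theorem series_decomposition_mean_zero
    (C : ℕ → ℂ) (k : ℕ) (hk : 0 < k)
    (hper : ∀ n : ℕ, C (n + k) = C n)
    (hmean : ∑ j ∈ Finset.range k, C j = 0)
    (s : Polynomial ℝ) (hdeg : 0 < s.natDegree) (hlead : 0 < s.leadingCoeff)
    (q : ℝ) (hq : q ∈ Set.Ioo (0 : ℝ) 1) :
    Summable (fun n : ℕ => ‖C n * ((q ^ (s.eval (n : ℝ)) : ℝ) : ℂ)‖) ∧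
    (∀ j : ℕ, j ≤ k - 2 →
      Summable (fun n : ℕ =>
        |q ^ (s.eval ((n * k + j : ℕ) : ℝ)) - q ^ (s.eval ((n * k + k - 1 : ℕ) : ℝ))|)) ∧
    (∑' n : ℕ, C n * ((q ^ (s.eval (n : ℝ)) : ℝ) : ℂ))
      = ∑ j ∈ Finset.range (k - 1), C j *
          ((∑' n : ℕ,
            (q ^ (s.eval ((n * k + j : ℕ) : ℝ)) - q ^ (s.eval ((n * k + k - 1 : ℕ) : ℝ))) : ℝ) : ℂ) := by
  obtain ⟨m, rfl⟩ : ∃ m, k = m + 1 := ⟨k - 1, by omega⟩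
  have hf := summable_aux s hdeg hlead q hq
  set f : ℕ → ℝ := fun n => q ^ (s.eval (n : ℝ)) with hfdef
  have hC : ∀ n j : ℕ, C (n * (m + 1) + j) = C j := by
    intro n j
    induction n with
    | zero => simp
    | succ n ih => rw [← ih, ← hper (n * (m + 1) + j)]; congr 1; ring
  have hsub : ∀ j : ℕ, Summable (fun n : ℕ => f (n * (m + 1) + j)) := by
    intro j
    refine hf.comp_injective (i := fun n : ℕ => n * (m + 1) + j) ?_
    intro a b hab
    have h1 : a * (m + 1) = b * (m + 1) := by simpa using hab
    exact Nat.eq_of_mul_eq_mul_right (by omega) h1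
  have hsum : Summable (fun n : ℕ => ‖C n * ((f n : ℝ) : ℂ)‖) := by
    refine Summable.of_nonneg_of_le (fun n => norm_nonneg _) (fun n => ?_)
      (hf.mul_left (∑ j ∈ Finset.range (m + 1), ‖C j‖))
    have h0 : 0 ≤ f n := Real.rpow_nonneg hq.1.le _
    rw [norm_mul, Complex.norm_real, Real.norm_of_nonneg h0]
    refine mul_le_mul_of_nonneg_right ?_ h0
    have h1 : C n = C (n % (m + 1)) := by
      conv_lhs => rw [← Nat.div_add_mod' n (m + 1)]
      exact hC _ _
    rw [h1]
    exact Finset.single_le_sum (f := fun j => ‖C j‖) (fun j _ => norm_nonneg _)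
      (Finset.mem_range.2 (Nat.mod_lt _ (by omega)))
  refine ⟨hsum, fun j _ => ((hsub j).sub (hsub m)).abs, ?_⟩
  have hF : Summable (fun n : ℕ => C n * ((f n : ℝ) : ℂ)) := hsum.of_norm
  have key : ∑' n : ℕ, C n * ((f n : ℝ) : ℂ)
      = ∑ j ∈ Finset.range (m + 1), C j * ((∑' n : ℕ, f (n * (m + 1) + j) : ℝ) : ℂ) := by
    rw [← (Nat.divModEquiv (m + 1)).symm.tsum_eq,
      ← (Equiv.prodComm (Fin (m + 1)) ℕ).tsum_eq, Summable.tsum_prod, tsum_fintype,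
      Finset.sum_range]
    · refine Finset.sum_congr rfl fun j _ => ?_
      rw [Complex.ofReal_tsum, ← tsum_mul_left]
      refine tsum_congr fun n => ?_
      have h2 : (Nat.divModEquiv (m + 1)).symm ((Equiv.prodComm (Fin (m + 1)) ℕ) (j, n))
          = n * (m + 1) + j := by
        simp [Nat.divModEquiv]
      rw [h2, hC]
    · exact ((Nat.divModEquiv (m + 1)).symm.summable_iff.2 hF).comp_injective
        (Equiv.prodComm (Fin (m + 1)) ℕ).injective
  have hR : ∀ j : ℕ, (∑' n : ℕ, (q ^ (s.eval ((n * (m + 1) + j : ℕ) : ℝ))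
      - q ^ (s.eval ((n * (m + 1) + (m + 1) - 1 : ℕ) : ℝ))))
      = (∑' n : ℕ, f (n * (m + 1) + j)) - ∑' n : ℕ, f (n * (m + 1) + m) := fun j =>
    (hsub j).tsum_sub (hsub m)
  simp only [hR]
  change ∑' n : ℕ, C n * ((f n : ℝ) : ℂ) = _
  rw [key, Finset.sum_range_succ]
  rw [Finset.sum_range_succ] at hmean
  simp only [Nat.add_sub_cancel, Complex.ofReal_sub, mul_sub, Finset.sum_sub_distrib,
    ← Finset.sum_mul]
  linear_combination ((∑' n : ℕ, f (n * (m + 1) + m) : ℝ) : ℂ) * hmean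
end

section
/- Let s(t) be a real polynomial of degree d ≥ 1 satisfying s(n) > 0 for every integer n ≥ 0, and let σ be a real number with σ > 1/d. Then the function x ↦ (Σ_{n≥0} e^{−x·s(n)}) · x^{σ−1} is integrable on (0, ∞), the series Σ_{n≥0} s(n)^{−σ} converges, and ∫₀^∞ (Σ_{n≥0} e^{−x·s(n)}) x^{σ−1} dx = Γ(σ) · Σ_{n≥0} s(n)^{−σ}. -/
lemma aux_summable_s11
    (s : Polynomial ℝ) (d : ℕ) (hd : s.natDegree = d) (hdeg : 1 ≤ d)
    (hpos : ∀ n : ℕ, 0 < s.eval (n : ℝ))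
    (σ : ℝ) (hσ : 1 / (d : ℝ) < σ) :
    Summable (fun n : ℕ => (s.eval (n : ℝ)) ^ (-σ)) := by
  have hd0 : (0 : ℝ) < d := by exact_mod_cast hdeg
  have hσ0 : 0 < σ := lt_trans (by positivity) hσ
  have hs0 : s ≠ 0 := by
    rintro rfl
    simpa using hpos 0
  have hO : (fun x : ℝ => s.leadingCoeff * x ^ s.natDegree) =O[Filter.atTop]
      (fun x => s.eval x) := s.isEquivalent_atTop_lead.symm.isBigO
  have hO2 : (fun x : ℝ => x ^ d) =O[Filter.atTop] (fun x => s.eval x) := by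
    rw [hd] at hO
    exact (Asymptotics.isBigO_const_mul_left_iff
      (Polynomial.leadingCoeff_ne_zero.mpr hs0)).mp hO
  have hO3 := hO2.comp_tendsto (tendsto_natCast_atTop_atTop (R := ℝ))
  obtain ⟨C, hC, hb⟩ := hO3.exists_pos
  have hb := hb.bound
  have hS : Summable (fun n : ℕ => C ^ σ * (n : ℝ) ^ (-(d * σ))) := by
    apply Summable.mul_left
    rw [Real.summable_nat_rpow]
    rw [div_lt_iff₀ hd0] at hσ
    linarith
  refine hS.of_norm_bounded_eventually_nat ?_
  filter_upwards [hb, Filter.eventually_gt_atTop 0] with n hn hn0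
  have hn0' : (0 : ℝ) < n := by exact_mod_cast hn0
  have hp := hpos n
  simp only [Function.comp, Real.norm_eq_abs] at hn
  rw [abs_of_pos hp, abs_of_pos (by positivity)] at hn
  rw [Real.norm_eq_abs, abs_of_pos (by positivity)]
  have h1 : ((n : ℝ) ^ d) ^ σ ≤ (C * s.eval (n : ℝ)) ^ σ :=
    Real.rpow_le_rpow (by positivity) hn hσ0.le
  rw [Real.mul_rpow hC.le hp.le, ← Real.rpow_natCast, ← Real.rpow_mul hn0'.le] at h1
  rw [Real.rpow_neg hp.le, Real.rpow_neg hn0'.le, ← div_eq_mul_inv, le_div_iff₀ (by positivity),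
    inv_mul_le_iff₀ (by positivity)]
  linarith

/-- Mellin-transform identity: if `s` is a real polynomial of degree `d ≥ 1` with
`s(n) > 0` for all integers `n ≥ 0` and `σ > 1/d`, then
`x ↦ (Σ_{n≥0} e^{−x·s(n)})·x^{σ−1}` is integrable on `(0,∞)`, the series
`Σ_{n≥0} s(n)^{−σ}` converges, and the integral equals `Γ(σ)·Σ_{n≥0} s(n)^{−σ}`. -/
theorem mellin_transform_of_theta_like_sum
    (s : Polynomial ℝ) (d : ℕ) (hd : s.natDegree = d) (hdeg : 1 ≤ d)
    (hpos : ∀ n : ℕ, 0 < s.eval (n : ℝ))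
    (σ : ℝ) (hσ : 1 / (d : ℝ) < σ) :
    MeasureTheory.IntegrableOn
      (fun x : ℝ => (∑' n : ℕ, Real.exp (-(x * s.eval (n : ℝ)))) * x ^ (σ - 1))
      (Set.Ioi (0 : ℝ)) ∧
    Summable (fun n : ℕ => (s.eval (n : ℝ)) ^ (-σ)) ∧
    (∫ x in Set.Ioi (0 : ℝ),
        (∑' n : ℕ, Real.exp (-(x * s.eval (n : ℝ)))) * x ^ (σ - 1))
      = Real.Gamma σ * ∑' n : ℕ, (s.eval (n : ℝ)) ^ (-σ) := by
  have hsum := aux_summable_s11 s d hd hdeg hpos σ hσ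
  have hd0 : (0 : ℝ) < d := by exact_mod_cast hdeg
  have hσ0 : 0 < σ := lt_trans (by positivity) hσ
  have hint : ∀ n : ℕ, MeasureTheory.Integrable
      (fun x : ℝ => Real.exp (-(x * s.eval (n : ℝ))) * x ^ (σ - 1))
      (MeasureTheory.volume.restrict (Set.Ioi (0 : ℝ))) := by
    intro n
    have h := integrableOn_rpow_mul_exp_neg_mul_rpow (p := 1) (s := σ - 1)
      (by linarith) one_pos (hpos n)
    refine h.congr (Filter.Eventually.of_forall fun x => ?_)
    simp only [Real.rpow_one]
    rw [mul_comm, neg_mul, mul_comm x]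
  have hval : ∀ n : ℕ, (∫ x in Set.Ioi (0 : ℝ),
      Real.exp (-(x * s.eval (n : ℝ))) * x ^ (σ - 1)) =
      Real.Gamma σ * (s.eval (n : ℝ)) ^ (-σ) := by
    intro n
    have h := Real.integral_rpow_mul_exp_neg_mul_Ioi hσ0 (hpos n)
    rw [one_div, Real.inv_rpow (hpos n).le, ← Real.rpow_neg (hpos n).le, mul_comm] at h
    rw [← h]
    congr 1
    ext x
    rw [mul_comm, mul_comm x]
  have hnorm : ∀ n : ℕ, (∫ x in Set.Ioi (0 : ℝ),
      ‖Real.exp (-(x * s.eval (n : ℝ))) * x ^ (σ - 1)‖) =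
      Real.Gamma σ * (s.eval (n : ℝ)) ^ (-σ) := by
    intro n
    rw [← hval n]
    refine MeasureTheory.setIntegral_congr_fun measurableSet_Ioi fun x hx => ?_
    have hx : 0 < x := hx
    exact Real.norm_of_nonneg (by positivity)
  have key := MeasureTheory.hasSum_integral_of_summable_integral_norm hint
    (by simp only [hnorm]; exact hsum.mul_left _)
  simp only [hval, tsum_mul_right] at key
  have heq := key.unique (hsum.hasSum.mul_left (Real.Gamma σ))
  refine ⟨?_, hsum, heq⟩
  by_contra hni
  have h0 := MeasureTheory.integral_undef hni
  rw [heq] at h0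
  have h1 : 0 < ∑' n : ℕ, (s.eval (n : ℝ)) ^ (-σ) :=
    hsum.tsum_pos (fun n => (Real.rpow_pos_of_pos (hpos n) _).le) 0
      (Real.rpow_pos_of_pos (hpos 0) _)
  exact (mul_pos (Real.Gamma_pos_of_pos hσ0) h1).ne' h0
end

section
/- Let s(t) be a real polynomial of degree d ≥ 1 with positive leading coefficient a_d. Then lim_{q→1⁻} (−log q)^{1/d} · ∫₀^∞ q^{s(t)} dt = Γ(1/d) / (d · a_d^{1/d}), where the limit is taken over q ∈ (0,1). -/
open Filter Topology

theorem lia_lower (s : Polynomial ℝ) (hlead : 0 < s.leadingCoeff) :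
    ∃ C : ℝ, 0 ≤ C ∧ ∀ t : ℝ, 0 ≤ t →
      s.leadingCoeff / 2 * t ^ s.natDegree - C ≤ s.eval t := by
  have h1 := (s.isEquivalent_atTop_lead).isLittleO.bound (c := 1 / 2) (by norm_num)
  obtain ⟨T, hT⟩ := eventually_atTop.1 h1
  have hc : ContinuousOn (fun t : ℝ => s.leadingCoeff / 2 * t ^ s.natDegree - s.eval t)
      (Set.Icc 0 T) := by
    apply Continuous.continuousOn
    fun_prop
  obtain ⟨C, hC⟩ := (isCompact_Icc.bddAbove_image hc)
  refine ⟨max C 0, le_max_right _ _, fun t ht => ?_⟩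
  rcases le_total t T with h | h
  · have := hC ⟨t, ⟨ht, h⟩, rfl⟩
    have := le_max_left C 0
    simp only at *
    linarith
  · have h2 := hT t h
    have h3 : 0 ≤ s.leadingCoeff * t ^ s.natDegree := by positivity
    simp only [Pi.sub_apply, Real.norm_eq_abs] at h2
    rw [abs_of_nonneg h3] at h2
    have := (abs_le.1 h2).1
    have := le_max_right C 0
    linarith

theorem lia_pointwise (s : Polynomial ℝ) (hdeg : 1 ≤ s.natDegree) (u : ℝ) :
    Tendsto (fun h : ℝ => h ^ s.natDegree * s.eval (h⁻¹ * u)) (𝓝[>] 0)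
      (𝓝 (s.leadingCoeff * u ^ s.natDegree)) := by
  have hc : Continuous (fun h : ℝ => ∑ i ∈ Finset.range (s.natDegree + 1),
      s.coeff i * u ^ i * h ^ (s.natDegree - i)) := by fun_prop
  have h0 := (hc.tendsto 0).mono_left (nhdsWithin_le_nhds (s := Set.Ioi 0))
  have e : ∑ i ∈ Finset.range (s.natDegree + 1),
      s.coeff i * u ^ i * (0 : ℝ) ^ (s.natDegree - i) = s.leadingCoeff * u ^ s.natDegree := by
    rw [Finset.sum_range_succ, Finset.sum_eq_zero]
    · simp
    · intro i hi
      have := Finset.mem_range.1 hi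
      rw [zero_pow (by omega), mul_zero]
  rw [e] at h0
  refine h0.congr' ?_
  filter_upwards [self_mem_nhdsWithin] with h hh
  have hh : h ≠ 0 := ne_of_gt hh
  rw [Polynomial.eval_eq_sum_range, Finset.mul_sum]
  refine Finset.sum_congr rfl fun i hi => ?_
  have := Finset.mem_range.1 hi
  rw [pow_sub₀ _ hh (by omega), mul_pow, inv_pow]
  ring

theorem lia_main (s : Polynomial ℝ) (hdeg : 1 ≤ s.natDegree) (hlead : 0 < s.leadingCoeff) :
    Tendsto (fun h : ℝ => ∫ u in Set.Ioi (0 : ℝ),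
        Real.exp (-(h ^ s.natDegree * s.eval (h⁻¹ * u)))) (𝓝[>] 0)
      (𝓝 (∫ u in Set.Ioi (0 : ℝ), Real.exp (-(s.leadingCoeff * u ^ s.natDegree)))) := by
  obtain ⟨C, hC0, hC⟩ := lia_lower s hlead
  refine MeasureTheory.tendsto_integral_filter_of_dominated_convergence
    (fun u => Real.exp C * Real.exp (-(s.leadingCoeff / 2) * u ^ s.natDegree)) ?_ ?_ ?_ ?_
  · refine Eventually.of_forall fun h => ?_
    apply Continuous.aestronglyMeasurable
    fun_prop
  · have h1 : ∀ᶠ h : ℝ in 𝓝[>] 0, h < 1 :=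
      nhdsWithin_le_nhds (Iio_mem_nhds (by norm_num))
    filter_upwards [self_mem_nhdsWithin, h1] with h hh hh1
    have hh : 0 < h := hh
    refine (MeasureTheory.ae_restrict_iff' measurableSet_Ioi).2 (Eventually.of_forall ?_)
    intro u hu
    have hu : 0 < u := hu
    rw [Real.norm_eq_abs, Real.abs_exp, ← Real.exp_add, Real.exp_le_exp]
    have h2 := hC (h⁻¹ * u) (by positivity)
    have h3 := mul_le_mul_of_nonneg_left h2 (by positivity : 0 ≤ h ^ s.natDegree)
    have h4 : h ^ s.natDegree ≤ 1 := pow_le_one₀ hh.le hh1.le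
    have h5 : h ^ s.natDegree * (s.leadingCoeff / 2 * (h⁻¹ * u) ^ s.natDegree - C)
        = s.leadingCoeff / 2 * u ^ s.natDegree - h ^ s.natDegree * C := by
      rw [mul_pow, inv_pow]
      have : h ^ s.natDegree ≠ 0 := by positivity
      field_simp
    nlinarith
  · have := integrableOn_rpow_mul_exp_neg_mul_rpow (p := s.natDegree) (s := 0)
      (b := s.leadingCoeff / 2) (by norm_num) (by exact_mod_cast hdeg) (by positivity)
    simp only [Real.rpow_zero, one_mul, Real.rpow_natCast] at this
    exact this.const_mul _
  · refine Eventually.of_forall fun u => ?_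
    exact (Real.continuous_exp.tendsto _).comp (lia_pointwise s hdeg u).neg

/-- Leading asymptotics of the Laplace-type integral: if `s` is a real polynomial of
degree `d ≥ 1` with positive leading coefficient `a_d`, then
`lim_{q→1⁻} (−log q)^{1/d} · ∫₀^∞ q^{s(t)} dt = Γ(1/d) / (d · a_d^{1/d})`. -/
theorem laplace_integral_asymptotics
    (s : Polynomial ℝ) (d : ℕ) (hd : s.natDegree = d) (hdeg : 1 ≤ d)
    (hlead : 0 < s.leadingCoeff) :
    Tendsto
      (fun q : ℝ =>
        (-Real.log q) ^ (1 / (d : ℝ)) * ∫ t in Set.Ioi (0 : ℝ), q ^ (s.eval t))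
      (𝓝[Set.Ioo (0 : ℝ) 1] 1)
      (𝓝 (Real.Gamma (1 / (d : ℝ)) / ((d : ℝ) * s.leadingCoeff ^ (1 / (d : ℝ))))) := by
  subst hd
  have hdpos : (0 : ℝ) < s.natDegree := by exact_mod_cast hdeg
  have hval : ∫ u in Set.Ioi (0 : ℝ), Real.exp (-(s.leadingCoeff * u ^ s.natDegree))
      = Real.Gamma (1 / (s.natDegree : ℝ)) /
        ((s.natDegree : ℝ) * s.leadingCoeff ^ (1 / (s.natDegree : ℝ))) := by
    have := integral_exp_neg_mul_rpow hdpos hlead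
    simp only [Real.rpow_natCast, neg_mul] at this
    rw [this, Real.Gamma_add_one (by positivity), neg_div, Real.rpow_neg hlead.le]
    field_simp
  rw [← hval]
  have hlim : Tendsto (fun q : ℝ => (-Real.log q) ^ (1 / (s.natDegree : ℝ)))
      (𝓝[Set.Ioo (0 : ℝ) 1] 1) (𝓝[>] 0) := by
    refine tendsto_nhdsWithin_iff.2 ⟨?_, ?_⟩
    · have h1 : Tendsto (fun q : ℝ => -Real.log q) (𝓝[Set.Ioo (0 : ℝ) 1] 1) (𝓝 0) := by
        have := (Real.continuousAt_log (one_ne_zero)).tendsto.neg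
        rw [Real.log_one, neg_zero] at this
        exact this.mono_left nhdsWithin_le_nhds
      have := h1.rpow_const (p := 1 / (s.natDegree : ℝ)) (Or.inr (by positivity))
      rwa [Real.zero_rpow (by positivity)] at this
    · filter_upwards [self_mem_nhdsWithin] with q hq
      exact Real.rpow_pos_of_pos (neg_pos.2 (Real.log_neg hq.1 hq.2)) _
  refine ((lia_main s hdeg hlead).comp hlim).congr' ?_
  filter_upwards [self_mem_nhdsWithin] with q hq
  have hl : 0 < -Real.log q := neg_pos.2 (Real.log_neg hq.1 hq.2)
  have hh : 0 < (-Real.log q) ^ (1 / (s.natDegree : ℝ)) := Real.rpow_pos_of_pos hl _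
  have hp : ((-Real.log q) ^ (1 / (s.natDegree : ℝ))) ^ s.natDegree = -Real.log q := by
    rw [one_div]
    exact Real.rpow_inv_natCast_pow hl.le (by omega)
  simp only [Function.comp]
  rw [hp]
  have := MeasureTheory.integral_comp_mul_left_Ioi (fun t => q ^ (s.eval t)) 0 (inv_pos.2 hh)
  rw [inv_inv, mul_zero, smul_eq_mul] at this
  rw [← this]
  refine MeasureTheory.integral_congr_ae (Eventually.of_forall fun u => ?_)
  simp only
  rw [Real.rpow_def_of_pos hq.1]
  congr 1
  ring
end

section
/- Let f : [0,1] → [0,1] be a continuous function. Then lim_{q→1⁻} (1−q) Σ_{n≥0} f(q^n) q^n = ∫₀¹ f(x) dx, where the limit is taken over q ∈ (0,1). -/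
open Filter Topology

/-- The `q`-integral: for a continuous `f : [0,1] → [0,1]`,
`lim_{q→1⁻} (1−q) Σ_{n≥0} f(q^n) q^n = ∫₀¹ f(x) dx`. -/
theorem q_integral_limit
    (f : ℝ → ℝ)
    (hf_cont : ContinuousOn f (Set.Icc (0 : ℝ) 1))
    (hf_maps : ∀ x ∈ Set.Icc (0 : ℝ) 1, f x ∈ Set.Icc (0 : ℝ) 1) :
    Tendsto
      (fun q : ℝ => (1 - q) * ∑' n : ℕ, f (q ^ n) * q ^ n)
      (𝓝[Set.Ioo (0 : ℝ) 1] 1) (𝓝 (∫ x in (0 : ℝ)..1, f x)) := by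
  have hint : ∀ a ∈ Set.Icc (0 : ℝ) 1, ∀ b ∈ Set.Icc (0 : ℝ) 1,
      IntervalIntegrable f MeasureTheory.volume a b := by
    intro a ha b hb
    exact (hf_cont.mono (Set.uIcc_subset_Icc ha hb)).intervalIntegrable
  have huc : UniformContinuousOn f (Set.Icc (0 : ℝ) 1) :=
    isCompact_Icc.uniformContinuousOn_of_continuous hf_cont
  rw [Metric.uniformContinuousOn_iff] at huc
  rw [Metric.tendsto_nhdsWithin_nhds]
  intro ε hε
  obtain ⟨δ, hδ, H⟩ := huc (ε / 2) (by positivity)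
  refine ⟨δ, hδ, ?_⟩
  intro q hq hqd
  obtain ⟨hq0, hq1⟩ := hq
  rw [Real.dist_eq, abs_sub_comm, abs_of_pos (by linarith)] at hqd
  have hmem : ∀ n : ℕ, q ^ n ∈ Set.Icc (0 : ℝ) 1 := fun n =>
    ⟨by positivity, pow_le_one₀ hq0.le hq1.le⟩
  have h1 : (1 : ℝ) ∈ Set.Icc (0 : ℝ) 1 := by simp
  have h0 : (0 : ℝ) ∈ Set.Icc (0 : ℝ) 1 := by simp
  have hsum : Summable (fun n : ℕ => f (q ^ n) * q ^ n) := by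
    refine Summable.of_nonneg_of_le (fun n => ?_) (fun n => ?_)
      (summable_geometric_of_lt_one hq0.le hq1)
    · exact mul_nonneg (hf_maps _ (hmem n)).1 (hmem n).1
    · exact mul_le_of_le_one_left (hmem n).1 (hf_maps _ (hmem n)).2
  have hstep : ∀ n : ℕ, |(1 - q) * (f (q ^ n) * q ^ n) - ∫ x in (q ^ (n+1))..(q ^ n), f x|
      ≤ ε / 2 * (q ^ n - q ^ (n+1)) := by
    intro n
    have hle : q ^ (n+1) ≤ q ^ n := pow_le_pow_of_le_one hq0.le hq1.le (Nat.le_succ n)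
    have e : (1 - q) * (f (q ^ n) * q ^ n) - ∫ x in (q ^ (n+1))..(q ^ n), f x
        = ∫ x in (q ^ (n+1))..(q ^ n), (f (q ^ n) - f x) := by
      rw [intervalIntegral.integral_sub (by simp) (hint _ (hmem _) _ (hmem _))]
      rw [intervalIntegral.integral_const, smul_eq_mul]
      ring
    rw [e]
    have := intervalIntegral.norm_integral_le_of_norm_le_const (a := q ^ (n+1)) (b := q ^ n)
      (f := fun x => f (q ^ n) - f x) (C := ε / 2) ?_
    · rwa [abs_of_nonneg (sub_nonneg.2 hle)] at this
    · intro x hx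
      rw [Set.uIoc_of_le hle] at hx
      have hxm : x ∈ Set.Icc (0 : ℝ) 1 :=
        ⟨(hmem (n+1)).1.trans hx.1.le, hx.2.trans (hmem n).2⟩
      have := H (q ^ n) (hmem n) x hxm ?_
      · exact this.le
      · rw [Real.dist_eq, abs_of_nonneg (by linarith [hx.2])]
        have h2 : q ^ n - q ^ (n+1) = q ^ n * (1 - q) := by ring
        have h3 : q ^ n * (1 - q) ≤ 1 - q :=
          mul_le_of_le_one_left (by linarith) (hmem n).2
        linarith [hx.1]
  have hfin : ∀ N : ℕ, |(1 - q) * ∑ n ∈ Finset.range N, f (q ^ n) * q ^ n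
      - ∫ x in (q ^ N)..1, f x| ≤ ε / 2 * (1 - q ^ N) := by
    intro N
    induction N with
    | zero => simp
    | succ N ih =>
      rw [Finset.sum_range_succ, ← intervalIntegral.integral_add_adjacent_intervals
        (hint _ (hmem (N+1)) _ (hmem N)) (hint _ (hmem N) _ h1)]
      have h5 := abs_le.1 ih
      have h6 := abs_le.1 (hstep N)
      rw [abs_le, mul_add]
      constructor <;> linarith [h5.1, h5.2, h6.1, h6.2]
  have hlim0 : Tendsto (fun N : ℕ => ∫ x in (0:ℝ)..(q ^ N), f x) atTop (𝓝 0) := by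
    refine squeeze_zero_norm (fun N => ?_) (tendsto_pow_atTop_nhds_zero_of_lt_one hq0.le hq1)
    have := intervalIntegral.norm_integral_le_of_norm_le_const (a := 0) (b := q ^ N)
      (f := f) (C := 1) ?_
    · simpa [abs_of_pos hq0] using this
    · intro x hx
      rw [Set.uIoc_of_le (hmem N).1] at hx
      have := hf_maps x ⟨hx.1.le, hx.2.trans (hmem N).2⟩
      rw [Real.norm_eq_abs, abs_of_nonneg this.1]
      exact this.2
  have hlim1 : Tendsto (fun N : ℕ => ∫ x in (q ^ N)..1, f x) atTop
      (𝓝 (∫ x in (0:ℝ)..1, f x)) := by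
    have := (tendsto_const_nhds (x := ∫ x in (0:ℝ)..1, f x)).sub hlim0
    rw [sub_zero] at this
    refine this.congr (fun N => ?_)
    rw [← intervalIntegral.integral_add_adjacent_intervals
      (hint _ h0 _ (hmem N)) (hint _ (hmem N) _ h1)]
    ring
  have hlim2 := ((hsum.hasSum.tendsto_sum_nat.const_mul (1 - q)).sub hlim1).abs
  have hfinal := le_of_tendsto hlim2 (Eventually.of_forall fun N =>
    (hfin N).trans (mul_le_of_le_one_right (by positivity) (by linarith [(hmem N).1])))
  rw [Real.dist_eq]
  linarith
end

section
/- Let k ≥ 2 be an integer and let j be an integer with 0 ≤ j ≤ k−2. For a > 1 set M(a) = (a^{k+j} − a^{k−1})/(a^{k−1} − a^j). Then there exists A > 1 such that for every real a ≥ A, the limit lim_{q→1⁻} Σ_{n≥0} q^{a^{kn} M(a)} (q^{a^{nk}} − q^{a^{nk+k}}) (over q ∈ (0,1)) does not exist; in fact there are two sequences q_r → 1⁻ and q'_r → 1⁻ in (0,1) along which the sums have distinct limit points. -/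
open Filter Topology

noncomputable def lrG (b M x : ℝ) : ℝ := Real.exp (-(x * M)) * (Real.exp (-x) - Real.exp (-(x * b)))

noncomputable def lrF (b M t : ℝ) : ℝ := ∑' n : ℕ, lrG b M (t * b ^ n)

lemma lrG_nonneg {b M x : ℝ} (hb : 2 ≤ b) (hx : 0 < x) : 0 ≤ lrG b M x := by
  unfold lrG
  apply mul_nonneg (Real.exp_pos _).le
  have : Real.exp (-(x * b)) ≤ Real.exp (-x) := Real.exp_le_exp.mpr (by nlinarith)
  linarith

lemma lrG_le1 {b M x : ℝ} (hb : 2 ≤ b) (hM : 0 < M) (hx : 0 < x) : lrG b M x ≤ b * x := by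
  unfold lrG
  have h1 : Real.exp (-(x * M)) ≤ 1 := Real.exp_le_one_iff.mpr (by nlinarith [mul_pos hx hM])
  have h2 : Real.exp (-x) ≤ 1 := Real.exp_le_one_iff.mpr (by linarith)
  have h3 := Real.add_one_le_exp (-(x * b))
  have h4 : Real.exp (-(x * b)) ≤ Real.exp (-x) := Real.exp_le_exp.mpr (by nlinarith)
  have h5 := Real.exp_pos (-(x * M))
  nlinarith

lemma lrexp_le {y : ℝ} (hy : 0 < y) : Real.exp (-y) ≤ 1 / (1 + y) := by
  rw [Real.exp_neg, inv_eq_one_div]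
  apply one_div_le_one_div_of_le (by linarith)
  linarith [Real.add_one_le_exp y]

lemma lrG_le2 {b M x : ℝ} (hM : 0 < M) (hx : 0 < x) : lrG b M x ≤ 1 / (M * x) := by
  have hp : 0 < M * x := mul_pos hM hx
  unfold lrG
  have h1 : Real.exp (-(x * M)) ≤ 1 / (M * x) := by
    rw [mul_comm x M]
    refine (lrexp_le hp).trans ?_
    exact one_div_le_one_div_of_le hp (by linarith)
  have h2 : Real.exp (-x) ≤ 1 := Real.exp_le_one_iff.mpr (by linarith)
  have h3 := Real.exp_pos (-(x * b))
  have h5 := Real.exp_pos (-(x * M))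
  nlinarith

lemma lrG_le3 {b M t : ℝ} (hb : 2 ≤ b) (hM : 0 < M) (ht : 0 < t) (n : ℕ) :
    lrG b M (t * b ^ n) ≤ 1 / (M * t) * (1 / 2) ^ n := by
  have hbn : (0:ℝ) < b ^ n := by positivity
  refine (lrG_le2 hM (mul_pos ht hbn)).trans ?_
  rw [one_div_pow, ← one_div_mul_one_div_rev, ← one_div_mul_one_div_rev, ← one_div_mul_one_div_rev]
  have : 1 / b ^ n ≤ 1 / 2 ^ n :=
    one_div_le_one_div_of_le (by positivity) (pow_le_pow_left₀ (by norm_num) hb n)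
  have h : 0 ≤ 1 / t * (1 / M) := by positivity
  nlinarith

lemma lrS {b M t : ℝ} (hb : 2 ≤ b) (hM : 0 < M) (ht : 0 < t) :
    Summable (fun n : ℕ => lrG b M (t * b ^ n)) := by
  refine Summable.of_nonneg_of_le (fun n => lrG_nonneg hb (by positivity)) (lrG_le3 hb hM ht) ?_
  exact summable_geometric_two.mul_left _

lemma lrF_le {b M t : ℝ} (hb : 2 ≤ b) (hM : 0 < M) (ht : 0 < t) : lrF b M t ≤ 2 / (M * t) := by
  have := (lrS hb hM ht).tsum_le_tsum (lrG_le3 hb hM ht) (summable_geometric_two.mul_left _)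
  rw [tsum_mul_left, tsum_geometric_two] at this
  unfold lrF
  calc _ ≤ _ := this
    _ = _ := by ring

lemma lrF_step {b M t : ℝ} (hb : 2 ≤ b) (hM : 0 < M) (ht : 0 < t) :
    lrF b M (t / b) = lrG b M (t / b) + lrF b M t := by
  unfold lrF
  rw [(lrS hb hM (by positivity : 0 < t / b)).tsum_eq_zero_add]
  simp only [pow_zero, mul_one]
  congr 2
  funext n
  congr 1
  field_simp
  ring

lemma lrF_upper {b M s : ℝ} (hb : 2 ≤ b) (hM : 0 < M) (hs : 0 < s) (r : ℕ) :
    lrF b M (s / b ^ r) ≤ 2 / (M * s) + 2 * s - 2 * (s / b ^ r) := by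
  induction r with
  | zero => simpa using lrF_le hb hM hs
  | succ r ih =>
    have hp : 0 < s / b ^ r := by positivity
    have e : s / b ^ (r + 1) = (s / b ^ r) / b := by rw [pow_succ, div_div]
    rw [e, lrF_step hb hM hp]
    set u := s / b ^ r
    have h1 := lrG_le1 hb hM (by positivity : 0 < u / b)
    have h2 : b * (u / b) = u := by field_simp
    have h3 : u / b ≤ u / 2 := by gcongr
    linarith

lemma lrF_lower {b M s : ℝ} (hb : 2 ≤ b) (hM : 0 < M) (hs : 0 < s) (r : ℕ) :
    lrG b M s ≤ lrF b M (s / b ^ r) := by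
  have hp : 0 < s / b ^ r := by positivity
  have := (lrS hb hM hp).le_tsum r (fun n _ => lrG_nonneg hb (by positivity))
  have e : s / b ^ r * b ^ r = s := by field_simp
  rw [e] at this
  exact this

lemma lrM {k j : ℕ} (hk : 2 ≤ k) (hj : j ≤ k - 2) {a : ℝ} (ha : 1000 ≤ a) :
    999 ≤ (a ^ (k + j) - a ^ (k - 1)) / (a ^ (k - 1) - a ^ j) ∧
    (a ^ (k + j) - a ^ (k - 1)) / (a ^ (k - 1) - a ^ j) * a ≤ 2 * a ^ k := by
  obtain ⟨i, rfl⟩ : ∃ i, k = j + i + 2 := ⟨k - 2 - j, by omega⟩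
  have e : j + i + 2 - 1 = j + i + 1 := by omega
  rw [e]
  have hP : 0 < a ^ j := by positivity
  have hP1 : 1 ≤ a ^ j := one_le_pow₀ (by linarith)
  have hQ : 1 ≤ a ^ i := one_le_pow₀ (by linarith)
  have e1 : a ^ (j + i + 2 + j) = a ^ j * a ^ i * a * (a ^ j * a) := by ring
  have e2 : a ^ (j + i + 1) = a ^ j * a ^ i * a := by ring
  have e3 : a ^ (j + i + 2) = a ^ j * a ^ i * a * a := by ring
  rw [e1, e2, e3]
  set P := a ^ j
  set Q := a ^ i
  have hPQ : P ≤ P * Q := by nlinarith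
  have h2 : 2 * P ≤ P * Q * a := by nlinarith
  have hd : 0 < P * Q * a - P := by linarith
  have hPa : 1000 ≤ P * a := by nlinarith
  have hN : 0 < P * Q * a := by linarith
  constructor
  · rw [le_div_iff₀ hd]
    nlinarith
  · rw [div_mul_eq_mul_div, div_le_iff₀ hd]
    have : P * a * (2 * P) ≤ P * a * (P * Q * a) := by gcongr
    have hQa : 0 ≤ Q * a := by positivity
    nlinarith [mul_le_mul_of_nonneg_left this hQa, mul_pos hN (by linarith : 0 < a)]

lemma lr_large {b M a : ℝ} (ha : 1000 ≤ a) (hab : a ≤ b) (hM : 999 ≤ M) (hMb : M * a ≤ 2 * b) :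
    1 / 2 ≤ lrG b M (2 / b) := by
  have hb : 0 < b := by linarith
  have h1 : 2 / b * b = 2 := by field_simp
  have h2 : 2 / b * M ≤ 4 / 1000 := by
    rw [div_mul_eq_mul_div, div_le_div_iff₀ hb (by norm_num)]
    nlinarith
  have h3 : 2 / b ≤ 2 / 1000 := by gcongr; linarith
  unfold lrG
  rw [h1]
  have h4 := Real.add_one_le_exp (-(2 / b * M))
  have h5 := Real.add_one_le_exp (-(2 / b))
  have h6 := lrexp_le (by norm_num : (0:ℝ) < 2)
  nlinarith

lemma lr_exp_form {k : ℕ} {a M t : ℝ} : (∑' n : ℕ, (Real.exp (-t)) ^ (a ^ (k * n) * M)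
      * ((Real.exp (-t)) ^ (a ^ (n * k)) - (Real.exp (-t)) ^ (a ^ (n * k + k))))
      = lrF (a ^ k) M t := by
  unfold lrF lrG
  congr 1
  funext n
  simp only [← Real.exp_mul]
  congr 2
  · ring
  · congr 1; ring
  · congr 1; ring

lemma lr_q {b s : ℝ} (hb : 2 ≤ b) (hs : 0 < s) :
    (∀ r : ℕ, Real.exp (-(s / b ^ r)) ∈ Set.Ioo (0:ℝ) 1) ∧
    Tendsto (fun r : ℕ => Real.exp (-(s / b ^ r))) atTop (𝓝 1) := by
  constructor
  · intro r
    refine ⟨Real.exp_pos _, Real.exp_lt_one_iff.mpr ?_⟩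
    have : 0 < s / b ^ r := by positivity
    linarith
  · have h : Tendsto (fun r : ℕ => s / b ^ r) atTop (𝓝 0) :=
      tendsto_const_nhds.div_atTop (tendsto_pow_atTop_atTop_of_one_lt (by linarith))
    have := (Real.continuous_exp.tendsto _).comp h.neg
    simpa [Function.comp_def] using this

/-- For `k ≥ 2`, `0 ≤ j ≤ k−2` and `M(a) = (a^{k+j} − a^{k−1})/(a^{k−1} − a^j)`,
there exists `A > 1` such that for every `a ≥ A` the limit
`lim_{q→1⁻} Σ_{n≥0} q^{a^{kn}M(a)} (q^{a^{nk}} − q^{a^{nk+k}})` does not exist; in fact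
there are two sequences in `(0,1)` tending to `1` along which the sums have distinct
limit points. -/
theorem lacunary_rectangle_sum_no_limit
    (k j : ℕ) (hk : 2 ≤ k) (hj : j ≤ k - 2) :
    ∃ A : ℝ, 1 < A ∧ ∀ a : ℝ, A ≤ a →
      (¬ ∃ L : ℝ,
        Tendsto
          (fun q : ℝ => ∑' n : ℕ,
            q ^ (a ^ (k * n) * ((a ^ (k + j) - a ^ (k - 1)) / (a ^ (k - 1) - a ^ j)))
              * (q ^ (a ^ (n * k)) - q ^ (a ^ (n * k + k))))
          (𝓝[Set.Ioo (0 : ℝ) 1] 1) (𝓝 L)) ∧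
      (∃ q₁ q₂ : ℕ → ℝ,
        (∀ r, q₁ r ∈ Set.Ioo (0 : ℝ) 1) ∧ (∀ r, q₂ r ∈ Set.Ioo (0 : ℝ) 1) ∧
        Tendsto q₁ atTop (𝓝 1) ∧ Tendsto q₂ atTop (𝓝 1) ∧
        ∃ L₁ L₂ : ℝ, L₁ ≠ L₂ ∧
          MapClusterPt L₁ atTop
            (fun r : ℕ => ∑' n : ℕ,
              (q₁ r) ^ (a ^ (k * n) * ((a ^ (k + j) - a ^ (k - 1)) / (a ^ (k - 1) - a ^ j)))
                * ((q₁ r) ^ (a ^ (n * k)) - (q₁ r) ^ (a ^ (n * k + k)))) ∧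
          MapClusterPt L₂ atTop
            (fun r : ℕ => ∑' n : ℕ,
              (q₂ r) ^ (a ^ (k * n) * ((a ^ (k + j) - a ^ (k - 1)) / (a ^ (k - 1) - a ^ j)))
                * ((q₂ r) ^ (a ^ (n * k)) - (q₂ r) ^ (a ^ (n * k + k))))) := by
  refine ⟨1000, by norm_num, fun a ha => ?_⟩
  obtain ⟨hM, hMb⟩ := lrM hk hj ha
  set M := (a ^ (k + j) - a ^ (k - 1)) / (a ^ (k - 1) - a ^ j) with hMdef
  have hab : a ≤ a ^ k := le_self_pow₀ (by linarith) (by omega)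
  have hlarge := lr_large ha hab hM hMb
  have hb : (2:ℝ) ≤ a ^ k := by linarith
  have hM0 : 0 < M := by linarith
  have hs : 0 < 2 / a ^ k := by positivity
  have hs' : (0:ℝ) < 1 / 10 := by norm_num
  obtain ⟨m1, t1⟩ := lr_q hb hs
  obtain ⟨m2, t2⟩ := lr_q hb hs'
  have lo : ∀ r : ℕ, 1 / 2 ≤ lrF (a ^ k) M (2 / a ^ k / (a ^ k) ^ r) :=
    fun r => hlarge.trans (lrF_lower hb hM0 hs r)
  have hi : ∀ r : ℕ, lrF (a ^ k) M (1 / 10 / (a ^ k) ^ r) ≤ 1 / 3 := by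
    intro r
    have h1 := lrF_upper hb hM0 hs' r
    have h2 : (0:ℝ) < 1 / 10 / (a ^ k) ^ r := by positivity
    have h3 : 2 / (M * (1 / 10)) ≤ 1 / 10 := by
      rw [div_le_div_iff₀ (by positivity) (by norm_num)]
      linarith
    linarith
  have hi0 : ∀ r : ℕ, 0 ≤ lrF (a ^ k) M (1 / 10 / (a ^ k) ^ r) := fun r =>
    (lrG_nonneg hb hs').trans (lrF_lower hb hM0 hs' r)
  constructor
  · rintro ⟨L, hL⟩
    have c1 := hL.comp (tendsto_nhdsWithin_iff.mpr ⟨t1, Eventually.of_forall m1⟩)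
    have c2 := hL.comp (tendsto_nhdsWithin_iff.mpr ⟨t2, Eventually.of_forall m2⟩)
    simp only [Function.comp_def, lr_exp_form] at c1 c2
    have := ge_of_tendsto' c1 lo
    have := le_of_tendsto' c2 hi
    linarith
  · refine ⟨_, _, m1, m2, t1, t2, ?_⟩
    simp only [lr_exp_form]
    obtain ⟨L₁, h1, h1'⟩ := (isCompact_Icc (a := (1 / 2 : ℝ))
      (b := 2 / (M * (2 / a ^ k)) + 2 * (2 / a ^ k))).exists_mapClusterPt (f := atTop)
      (u := fun r : ℕ => lrF (a ^ k) M (2 / a ^ k / (a ^ k) ^ r))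
      (tendsto_principal.mpr (Eventually.of_forall fun r => ⟨lo r, by
        have h1 := lrF_upper hb hM0 hs r
        have h2 : (0:ℝ) < 2 / a ^ k / (a ^ k) ^ r := by positivity
        linarith⟩))
    obtain ⟨L₂, h2, h2'⟩ := (isCompact_Icc (a := (0 : ℝ))
      (b := 1 / 3)).exists_mapClusterPt (f := atTop)
      (u := fun r : ℕ => lrF (a ^ k) M (1 / 10 / (a ^ k) ^ r))
      (tendsto_principal.mpr (Eventually.of_forall fun r => ⟨hi0 r, hi r⟩))
    refine ⟨L₁, L₂, ?_, h1', h2'⟩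
    have := h1.1
    have := h2.2
    intro h
    linarith
end
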